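/- Let p > 3 be a prime and d ∈ {2,3,4,6} with p not dividing 2d, and let t ∈ F_p with t ∉ {0, 1, 1/2}. Writing H₂(x) for the Beukers–Cohen–Mellit sum H_p({1/d, (d−1)/d},{1,1}; x) and H₃(x) for H_p({1/2, 1/d, (d−1)/d},{1,1,1}; x) (both defined via the Gauss-sum formula over F_p), one has H₂(t)² = H₃(4t(1−t)) + p. -/

import Mathlib

/-- The Beukers–Cohen–Mellit hypergeometric sum over `F_p` attached to a hypergeometric
datum defined over `ℚ`, written via the Gauss-sum formula: the datum is encoded by the lists
`P = (p_j)`, `Q = (q_k)` with `∏_j (X^{p_j}-1) / ∏_k (X^{q_k}-1) = ∏ (X-e^{2πia})/∏(X-e^{2πib})`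
and the constant `N = (-1)^{Σ q_k} ∏ p_j^{p_j} / ∏ q_k^{q_k}`; here `s m` is the multiplicity
of `X - e^{2πim/(p-1)}` in the gcd of the two products, and `ω` is a generator of the
character group of `F_p^×`. -/
noncomputable def BCM (p : ℕ) [Fact p.Prime] (ψ : AddChar (ZMod p) ℂ)
    (ω : MulChar (ZMod p) ℂ) (P Q : List ℕ) (N : ℤ) (t : ZMod p) : ℂ :=
  let s : ℕ → ℕ := fun m =>
    min (P.countP fun a => decide ((p - 1) ∣ m * a))
        (Q.countP fun a => decide ((p - 1) ∣ m * a))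
  ((-1 : ℂ) ^ (P.length + Q.length) / (1 - (p : ℂ))) *
    ∑ m ∈ Finset.range (p - 1),
      ((p : ℂ) ^ (s m) / (p : ℂ) ^ (s 0)) *
        (P.map fun j => gaussSum (ω ^ (m * j)) ψ).prod *
        (Q.map fun q => gaussSum ((ω ^ (m * q))⁻¹) ψ).prod *
        (ω ^ m) (((N : ZMod p))⁻¹ * t)

/-- Numerator lists for the datum `{1/d, (d-1)/d}, {1,1}`. -/
def P₂ : ℕ → List ℕ
  | 2 => [2, 2] | 3 => [3] | 4 => [4] | 6 => [6] | _ => []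

/-- Denominator lists for the datum `{1/d, (d-1)/d}, {1,1}`. -/
def Q₂ : ℕ → List ℕ
  | 2 => [1, 1, 1, 1] | 3 => [1, 1, 1] | 4 => [2, 1, 1] | 6 => [3, 2, 1] | _ => []

/-- The constant `N` for the datum `{1/d, (d-1)/d}, {1,1}`. -/
def N₂ : ℕ → ℤ
  | 2 => 16 | 3 => -27 | 4 => 64 | 6 => 432 | _ => 1

/-- Numerator lists for the datum `{1/2, 1/d, (d-1)/d}, {1,1,1}`. -/
def P₃ : ℕ → List ℕ
  | 2 => [2, 2, 2] | 3 => [2, 3] | 4 => [4] | 6 => [6] | _ => []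

/-- Denominator lists for the datum `{1/2, 1/d, (d-1)/d}, {1,1,1}`. -/
def Q₃ : ℕ → List ℕ
  | 2 => [1, 1, 1, 1, 1, 1] | 3 => [1, 1, 1, 1, 1] | 4 => [1, 1, 1, 1] | 6 => [3, 1, 1, 1] | _ => []

/-- The constant `N` for the datum `{1/2, 1/d, (d-1)/d}, {1,1,1}`. -/
def N₃ : ℕ → ℤ
  | 2 => 64 | 3 => -108 | 4 => 256 | 6 => 1728 | _ => 1

theorem sum_comp_eq_sum_card_mul {α β R : Type*} [Fintype α] [Fintype β] [DecidableEq β] [Ring R]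
    (u : α → β) (f : β → R) :
    ∑ x, f (u x) = ∑ a, ((Finset.univ.filter fun x => u x = a).card : R) * f a := by
  rw [← Finset.sum_fiberwise_of_maps_to (fun x _ => Finset.mem_univ (u x))]
  refine Finset.sum_congr rfl fun a _ => ?_
  rw [Finset.sum_congr rfl (g := fun _ => f a) fun x hx => by rw [(Finset.mem_filter.1 hx).2]]
  simp

section QuadraticCharSums

variable {F : Type*} [Field F] [Fintype F] [DecidableEq F]

local notation "φ" => quadraticChar F

theorem quadraticChar_mul_sq (a : F) {b : F} (hb : b ≠ 0) : φ (a * b ^ 2) = φ a := by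
  rw [map_mul, quadraticChar_sq_one' hb, mul_one]

theorem quadraticChar_mul_self {a : F} (ha : a ≠ 0) : φ a * φ a = 1 := by
  rw [← sq, quadraticChar_sq_one ha]

theorem card_sq_eq (hF : ringChar F ≠ 2) (a : F) :
    ((Finset.univ.filter fun x : F => x ^ 2 = a).card : ℤ) = 1 + φ a := by
  rw [add_comm, ← quadraticChar_card_sqrts hF a]
  congr 2
  ext x
  simp

theorem sum_comp_sq (hF : ringChar F ≠ 2) (f : F → ℤ) :
    ∑ x : F, f (x ^ 2) = ∑ a, (1 + φ a) * f a := by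
  rw [sum_comp_eq_sum_card_mul (fun x : F => x ^ 2) f]
  exact Finset.sum_congr rfl fun a _ => by rw [card_sq_eq hF]

theorem card_quadratic_eq (hF : ringChar F ≠ 2) {a : F} (ha : a ≠ 0) (b c : F) :
    ((Finset.univ.filter fun x : F => a * x ^ 2 + b * x + c = 0).card : ℤ)
      = 1 + φ (b ^ 2 - 4 * a * c) := by
  have h2 : (2 : F) ≠ 0 := Ring.two_ne_zero hF
  rw [← card_sq_eq hF, Nat.cast_inj]
  refine Finset.card_bij' (fun x _ => 2 * a * x + b) (fun y _ => (y - b) / (2 * a)) ?_ ?_ ?_ ?_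
  · intro x hx
    simp only [Finset.mem_filter, Finset.mem_univ, true_and] at hx ⊢
    linear_combination 4 * a * hx
  · intro y hy
    simp only [Finset.mem_filter, Finset.mem_univ, true_and] at hy ⊢
    have : 4 * a * (a * ((y - b) / (2 * a)) ^ 2 + b * ((y - b) / (2 * a)) + c) = 0 := by
      field_simp
      linear_combination 4 * hy
    have h4 : (4 : F) * a ≠ 0 := mul_ne_zero (by
      rw [show (4 : F) = 2 * 2 by norm_num]; exact mul_ne_zero h2 h2) ha
    exact (mul_eq_zero.1 this).resolve_left h4
  · intro x _
    field_simp
    ring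
  · intro y _
    field_simp
    ring

theorem sum_quadraticChar_affine (hF : ringChar F ≠ 2) {a : F} (ha : a ≠ 0) (b : F) :
    ∑ x : F, φ (a * x + b) = 0 := by
  rw [← quadraticChar_sum_zero hF]
  exact Fintype.sum_equiv ((Equiv.mulLeft₀ a ha).trans (Equiv.addRight b)) _ _ fun x => by simp

theorem sum_quadraticChar_sq_sub (hF : ringChar F ≠ 2) {D : F} (hD : D ≠ 0) :
    ∑ x : F, φ (x ^ 2 - D) = -1 := by
  rw [sum_comp_sq hF fun a => φ (a - D)]
  simp only [add_mul, one_mul, Finset.sum_add_distrib, ← map_mul]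
  have h0 : ∑ x : F, φ (x - D) = 0 := by
    simpa [sub_eq_add_neg] using sum_quadraticChar_affine hF one_ne_zero (-D)
  have h1 : ∑ x : F, φ (x * (x - D)) = ∑ y : F, (φ (-D * y + 1) - if y = 0 then 1 else 0) := by
    refine Fintype.sum_equiv (Equiv.inv F) _ _ fun x => ?_
    rcases eq_or_ne x 0 with rfl | hx
    · simp
    · simp only [Equiv.inv_apply, inv_eq_zero, hx, if_false, sub_zero]
      rw [← quadraticChar_mul_sq (-D * x⁻¹ + 1) hx]
      congr 1
      field_simp
      ring
  rw [h0, h1, Finset.sum_sub_distrib, sum_quadraticChar_affine hF (neg_ne_zero.2 hD)]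
  simp

theorem sum_quadraticChar_quadratic (hF : ringChar F ≠ 2) {a : F} (ha : a ≠ 0) (b c : F) :
    ∑ x : F, φ (a * x ^ 2 + b * x + c)
      = if b ^ 2 - 4 * a * c = 0 then (Fintype.card F - 1) * φ a else -φ a := by
  have h2 : (2 : F) ≠ 0 := Ring.two_ne_zero hF
  have h : ∑ x : F, φ (a * x ^ 2 + b * x + c)
      = φ a * ∑ y : F, φ (y ^ 2 - (b ^ 2 - 4 * a * c)) := by
    rw [Finset.mul_sum]
    refine Fintype.sum_equiv ((Equiv.mulLeft₀ (2 * a) (mul_ne_zero h2 ha)).trans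
      (Equiv.addRight b)) _ _ fun x => ?_
    rw [← map_mul, ← quadraticChar_mul_sq (a * x ^ 2 + b * x + c) (mul_ne_zero h2 ha)]
    congr 1
    simp
    ring
  rw [h]
  split_ifs with hD
  · have : ∀ y : F, φ (y ^ 2 - (b ^ 2 - 4 * a * c)) = 1 - if y = 0 then 1 else 0 := by
      intro y
      rw [hD, sub_zero]
      rcases eq_or_ne y 0 with rfl | hy
      · simp
      · simp [quadraticChar_sq_one' hy, hy]
    simp only [this, Finset.sum_sub_distrib]
    simp [mul_comm]
  · rw [sum_quadraticChar_sq_sub hF hD]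
    ring

/-- The pencil `q₂ - s q₁` of conics turns a quartic character sum into a cubic one. -/
theorem sum_quadraticChar_pencil (hF : ringChar F ≠ 2) {c G : F} (hc : c ≠ 0) (hG : G ≠ 0) :
    ∑ X : F, φ ((X ^ 2 - 4 * G) * (X ^ 2 - c * G * X + G ^ 2 + (c ^ 2 - 4) * G))
      = φ G * ∑ z : F, φ (z * (4 - G - z) * (4 - c ^ 2 - z)) - 1 := by
  have h2 : (2 : F) ≠ 0 := Ring.two_ne_zero hF
  have h4 : (4 : F) ≠ 0 := by rw [show (4 : F) = 2 * 2 by norm_num]; exact mul_ne_zero h2 h2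
  set q₁ : F → F := fun X => X ^ 2 - 4 * G
  set q₂ : F → F := fun X => X ^ 2 - c * G * X + G ^ 2 + (c ^ 2 - 4) * G
  have hsum : ∀ X, φ (q₁ X * q₂ X) = ∑ s : F, if q₂ X = s * q₁ X then φ s else 0 := by
    intro X
    rcases eq_or_ne (q₁ X) 0 with h1 | h1
    · rcases eq_or_ne (q₂ X) 0 with h3 | h3
      · simp [-quadraticChar_apply, h1, h3, quadraticChar_sum_zero hF, MulChar.map_zero]
      · simp [h1, h3]
    · have : ∀ s, q₂ X = s * q₁ X ↔ s = q₂ X / q₁ X := fun s => by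
        rw [eq_div_iff h1, eq_comm]
      simp only [this, Finset.sum_ite_eq', Finset.mem_univ, if_true]
      rw [← quadraticChar_mul_sq (q₂ X / q₁ X) h1]
      congr 1
      field_simp
  have hcount : ∀ s : F, (∑ X : F, if q₂ X = s * q₁ X then φ s else 0)
      = φ s * (1 + φ (G * (4 * (1 - s) - G) * (4 * (1 - s) - c ^ 2)))
        - if s = 1 then 1 else 0 := by
    intro s
    rw [← Finset.sum_filter, Finset.sum_const, nsmul_eq_mul, mul_comm]
    rcases eq_or_ne s 1 with rfl | hs
    · have hcard : (Finset.univ.filter fun X => q₂ X = 1 * q₁ X) = {(G + c ^ 2) / c} := by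
        ext X
        simp only [Finset.mem_filter, Finset.mem_univ, true_and, Finset.mem_singleton, q₁, q₂]
        rw [eq_div_iff hc]
        constructor
        · intro h
          apply mul_left_cancel₀ hG
          linear_combination -h
        · intro h
          linear_combination -G * h
      have hsq : G * (4 * (1 - 1) - G) * (4 * (1 - 1) - c ^ 2) = (G * c) ^ 2 := by ring
      rw [hcard, hsq, quadraticChar_sq_one' (mul_ne_zero hG hc)]
      simp
    · have hs' : 1 - s ≠ 0 := sub_ne_zero.2 hs.symm
      have hset : (Finset.univ.filter fun X => q₂ X = s * q₁ X)
          = Finset.univ.filter fun X => (1 - s) * X ^ 2 + (-(c * G)) * X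
            + (G ^ 2 + (c ^ 2 - 4) * G + 4 * G * s) = 0 := by
        ext X
        simp only [Finset.mem_filter, Finset.mem_univ, true_and, q₁, q₂]
        constructor <;> intro h <;> linear_combination h
      rw [hset, card_quadratic_eq hF hs', if_neg hs, sub_zero,
        ← quadraticChar_mul_sq (G * _ * _) (one_ne_zero)]
      congr 3
      ring
  simp only [show ∀ X, φ ((X ^ 2 - 4 * G) * (X ^ 2 - c * G * X + G ^ 2 + (c ^ 2 - 4) * G))
    = φ (q₁ X * q₂ X) from fun _ => rfl, hsum]
  rw [Finset.sum_comm]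
  simp only [hcount, mul_add, mul_one, Finset.sum_sub_distrib, Finset.sum_add_distrib,
    quadraticChar_sum_zero hF, zero_add, Finset.sum_ite_eq', Finset.mem_univ, if_true]
  congr 1
  rw [Finset.mul_sum]
  refine Fintype.sum_equiv (Equiv.mulLeft₀ 4 h4) _ _ fun s => ?_
  rw [← map_mul, ← map_mul, ← quadraticChar_mul_sq _ h2]
  congr 1
  simp
  ring

end QuadraticCharSums

/-- A finite commutative group `G` with a trace function `τ : G → F` behaving like
`y ↦ y + y⁻¹` on a rank-one torus over `F`: `τ` satisfies d'Alembert's functional equation,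
and its fibres are governed by the quadratic character and a sign `ε`
(`ε = 1` for the split torus, `ε = -1` for the nonsplit one). -/
structure TraceTorus (F G : Type*) [Field F] [Fintype F] [DecidableEq F] [CommGroup G]
    [Fintype G] where
  ε : ℤ
  ε_eq : ε = 1 ∨ ε = -1
  τ : G → F
  neg : G
  τ_one : τ 1 = 2
  τ_mul_τ : ∀ y z, τ y * τ z = τ (y * z) + τ (y * z⁻¹)
  τ_neg : ∀ y, τ (neg * y) = -τ y
  card_fiber_add : ∀ g X, τ g ≠ -2 →
    ((Finset.univ.filter fun y => τ y + τ (g * y⁻¹) = X).card : ℤ)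
      = 1 + ε * quadraticChar F (X ^ 2 - 4 * (τ g + 2))

namespace TraceTorus

variable {F G : Type*} [Field F] [Fintype F] [DecidableEq F] [CommGroup G] [Fintype G]

local notation "φ" => quadraticChar F

theorem ε_mul_self (T : TraceTorus F G) : T.ε * T.ε = 1 := by
  rcases T.ε_eq with h | h <;> simp [h]

theorem τ_inv (T : TraceTorus F G) (y : G) : T.τ y⁻¹ = T.τ y := by
  have h := T.τ_mul_τ 1 y
  rw [T.τ_one, one_mul, one_mul] at h
  linear_combination -h

theorem τ_neg_self (T : TraceTorus F G) : T.τ T.neg = -2 := by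
  simpa [T.τ_one] using T.τ_neg 1

theorem card_fiber (T : TraceTorus F G) (hF : ringChar F ≠ 2) (w : F) :
    ((Finset.univ.filter fun y => T.τ y = w).card : ℤ) = 1 + T.ε * φ (w ^ 2 - 4) := by
  have h2 : (2 : F) ≠ 0 := Ring.two_ne_zero hF
  have h := T.card_fiber_add 1 (2 * w) (by
    rw [T.τ_one]
    intro h
    exact mul_ne_zero h2 h2 (by linear_combination h))
  rw [T.τ_one, show (2 * w) ^ 2 - 4 * (2 + 2) = (w ^ 2 - 4) * 2 ^ 2 by ring,
    quadraticChar_mul_sq _ h2] at h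
  rw [← h]
  congr 2
  ext y
  simp only [Finset.mem_filter, Finset.mem_univ, true_and, one_mul, T.τ_inv, ← two_mul]
  exact (mul_right_inj' h2).symm

theorem sum_τ (T : TraceTorus F G) (hF : ringChar F ≠ 2) (f : F → ℤ) :
    ∑ y, f (T.τ y) = ∑ w, (1 + T.ε * φ (w ^ 2 - 4)) * f w := by
  rw [sum_comp_eq_sum_card_mul T.τ f]
  exact Finset.sum_congr rfl fun w _ => by rw [← T.card_fiber hF]

theorem eq_of_τ_sq_eq_four (T : TraceTorus F G) (hF : ringChar F ≠ 2) {y z : G}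
    (hy : T.τ y ^ 2 = 4) (h : T.τ z = T.τ y) : z = y := by
  have hc := T.card_fiber hF (T.τ y)
  rw [hy, sub_self, MulChar.map_zero, mul_zero, add_zero, Nat.cast_eq_one,
    Finset.card_eq_one] at hc
  obtain ⟨x, hx⟩ := hc
  have hz : z ∈ ({x} : Finset G) := hx ▸ by simp [h]
  have hy : y ∈ ({x} : Finset G) := hx ▸ by simp
  rw [Finset.mem_singleton.1 hz, Finset.mem_singleton.1 hy]

theorem τ_eq_two_iff (T : TraceTorus F G) (hF : ringChar F ≠ 2) {y : G} :
    T.τ y = 2 ↔ y = 1 :=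
  ⟨fun h => T.eq_of_τ_sq_eq_four hF (by rw [T.τ_one]; norm_num) (h.trans T.τ_one.symm),
    fun h => h ▸ T.τ_one⟩

theorem τ_eq_neg_two_iff (T : TraceTorus F G) (hF : ringChar F ≠ 2) {y : G} :
    T.τ y = -2 ↔ y = T.neg :=
  ⟨fun h => T.eq_of_τ_sq_eq_four hF (by rw [T.τ_neg_self]; norm_num) (h.trans T.τ_neg_self.symm),
    fun h => h ▸ T.τ_neg_self⟩

theorem neg_mul_neg (T : TraceTorus F G) (hF : ringChar F ≠ 2) : T.neg * T.neg = 1 := by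
  rw [← T.τ_eq_two_iff hF, T.τ_neg, T.τ_neg_self, neg_neg]

theorem card_eq (T : TraceTorus F G) (hF : ringChar F ≠ 2) :
    (Fintype.card G : ℤ) = Fintype.card F - T.ε := by
  have h4 : (4 : F) ≠ 0 := by
    rw [show (4 : F) = 2 * 2 by norm_num]
    exact mul_ne_zero (Ring.two_ne_zero hF) (Ring.two_ne_zero hF)
  have h := T.sum_τ hF fun _ => 1
  simp only [mul_one, Finset.sum_add_distrib, ← Finset.mul_sum,
    sum_quadraticChar_sq_sub hF h4] at h
  simpa [sub_eq_add_neg] using h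

theorem quadraticChar_τ_sq_sub_four (T : TraceTorus F G) (hF : ringChar F ≠ 2) {y : G}
    (hy : T.τ y ^ 2 ≠ 4) : φ (T.τ y ^ 2 - 4) = T.ε := by
  have hpos : 0 < (Finset.univ.filter fun z => T.τ z = T.τ y).card :=
    Finset.card_pos.2 ⟨y, by simp⟩
  have hc := T.card_fiber hF (T.τ y)
  rcases T.ε_eq with h | h <;>
    rcases quadraticChar_dichotomy (sub_ne_zero.2 hy) with h' | h' <;>
    rw [h, h'] at hc <;> rw [h, h'] <;> omega

/-- The quadratic character of a trace torus, see `TraceTorus.η`. -/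
def ηFun (T : TraceTorus F G) (y : G) : ℤ :=
  if T.τ y = -2 then T.ε * φ (-1) else φ (T.τ y + 2)

theorem ηFun_neg_mul (T : TraceTorus F G) (hF : ringChar F ≠ 2) (y : G) :
    T.ηFun (T.neg * y) = T.ε * φ (-1) * T.ηFun y := by
  have h2 : (2 : F) ≠ 0 := Ring.two_ne_zero hF
  have h22 : (2 : F) ≠ -2 := fun h => mul_ne_zero h2 h2 (by linear_combination h)
  have h4 : φ (2 + 2) = 1 := by
    rw [show (2 + 2 : F) = 2 ^ 2 by norm_num, quadraticChar_sq_one' h2]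
  have hn : T.ε * φ (-1) * (T.ε * φ (-1)) = 1 := by
    rw [mul_mul_mul_comm, T.ε_mul_self, quadraticChar_mul_self (neg_ne_zero.2 one_ne_zero),
      one_mul]
  unfold ηFun
  rw [T.τ_neg]
  by_cases h1 : T.τ y = -2
  · rw [if_pos h1, h1, neg_neg, if_neg h22, h4, hn]
  · by_cases h3 : T.τ y = 2
    · rw [h3, if_pos rfl, if_neg h22, h4, mul_one]
    · have h5 : T.τ y + 2 ≠ 0 := fun h => h1 (by linear_combination h)
      rw [if_neg h1, if_neg fun h => h3 (by linear_combination -h),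
        ← T.quadraticChar_τ_sq_sub_four hF fun h => (mul_ne_zero h5 (sub_ne_zero.2 h3)) (by
          linear_combination h), ← map_mul, ← map_mul,
        ← quadraticChar_mul_sq (-T.τ y + 2) h5]
      congr 1
      ring

theorem ηFun_mul_self (T : TraceTorus F G) (y : G) : T.ηFun y * T.ηFun y = 1 := by
  unfold ηFun
  split_ifs with h
  · rw [mul_mul_mul_comm, T.ε_mul_self, quadraticChar_mul_self (neg_ne_zero.2 one_ne_zero),
      one_mul]
  · exact quadraticChar_mul_self fun h' => h (by linear_combination h')

theorem ηFun_inv (T : TraceTorus F G) (y : G) : T.ηFun y⁻¹ = T.ηFun y := by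
  simp only [ηFun, T.τ_inv]

theorem ηFun_mul (T : TraceTorus F G) (hF : ringChar F ≠ 2) (y z : G) :
    T.ηFun (y * z) = T.ηFun y * T.ηFun z := by
  have hneg : T.ηFun T.neg = T.ε * φ (-1) := by simp [ηFun, T.τ_neg_self]
  by_cases hy : T.τ y = -2
  · rw [(T.τ_eq_neg_two_iff hF).1 hy, T.ηFun_neg_mul hF, hneg]
  by_cases hz : T.τ z = -2
  · rw [(T.τ_eq_neg_two_iff hF).1 hz, mul_comm, T.ηFun_neg_mul hF, hneg, mul_comm]
  by_cases hyz : T.τ (y * z) = -2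
  · have h := (T.τ_eq_neg_two_iff hF).1 hyz
    have hz' : z = T.neg * y⁻¹ := by rw [← h, mul_comm y, mul_inv_cancel_right]
    rw [h, hneg, hz', T.ηFun_neg_mul hF, T.ηFun_inv, mul_left_comm, T.ηFun_mul_self, mul_one]
  · have hy' : T.τ y + 2 ≠ 0 := fun h => hy (by linear_combination h)
    have hz' : T.τ z + 2 ≠ 0 := fun h => hz (by linear_combination h)
    have hyz' : T.τ (y * z) + 2 ≠ 0 := fun h => hyz (by linear_combination h)
    have key : (T.τ y + 2) * (T.τ z + 2) * (T.τ (y * z) + 2)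
        = (T.τ (y * z) + T.τ y + T.τ z + 2) ^ 2 := by
      have h1 := T.τ_mul_τ y z
      have h2 := T.τ_mul_τ (y * z) (y * z⁻¹)
      have h3 := T.τ_mul_τ y y
      have h4 := T.τ_mul_τ z z
      rw [mul_inv_cancel, T.τ_one] at h3 h4
      rw [show y * z * (y * z⁻¹) = y * y by rw [mul_mul_mul_comm, mul_inv_cancel, mul_one],
        show y * z * (y * z⁻¹)⁻¹ = z * z by rw [← div_eq_mul_inv]; simp [div_eq_mul_inv, mul_left_comm]] at h2
      linear_combination T.τ (y * z) * h1 + h2 - h3 - h4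
    unfold ηFun
    rw [if_neg hy, if_neg hz, if_neg hyz, ← map_mul]
    have h := quadraticChar_mul_self (mul_ne_zero hy' hz')
    have h' : φ ((T.τ y + 2) * (T.τ z + 2)) * φ (T.τ (y * z) + 2) = 1 := by
      rw [← map_mul, key]
      refine quadraticChar_sq_one' fun h0 => mul_ne_zero (mul_ne_zero hy' hz') hyz' ?_
      rw [key, h0]
      ring
    linear_combination φ ((T.τ y + 2) * (T.τ z + 2)) * h' - φ (T.τ (y * z) + 2) * h

/-- The quadratic character of a trace torus. -/
def η (T : TraceTorus F G) (hF : ringChar F ≠ 2) : G →* ℤ where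
  toFun := T.ηFun
  map_one' := by
    have h2 : (2 : F) ≠ 0 := Ring.two_ne_zero hF
    have h22 : (2 : F) ≠ -2 := fun h => mul_ne_zero h2 h2 (by linear_combination h)
    rw [ηFun, T.τ_one, if_neg h22, show (2 + 2 : F) = 2 ^ 2 by norm_num,
      quadraticChar_sq_one' h2]
  map_mul' := T.ηFun_mul hF

theorem η_neg (T : TraceTorus F G) (hF : ringChar F ≠ 2) :
    T.η hF T.neg = T.ε * φ (-1) := by
  simp [η, ηFun, T.τ_neg_self]

theorem η_of_ne (T : TraceTorus F G) (hF : ringChar F ≠ 2) {y : G} (hy : T.τ y ≠ -2) :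
    T.η hF y = φ (T.τ y + 2) := by
  simp only [η, MonoidHom.coe_mk, OneHom.coe_mk, ηFun, if_neg hy]

theorem η_mul_self (T : TraceTorus F G) (hF : ringChar F ≠ 2) (y : G) :
    T.η hF y * T.η hF y = 1 :=
  T.ηFun_mul_self y

theorem τ_sub_mul_τ_sub (T : TraceTorus F G) {g : G} (hg : T.τ g + 2 ≠ 0) (c : F) (y : G) :
    (T.τ y - c) * (T.τ (g * y⁻¹) - c)
      = (T.τ y + T.τ (g * y⁻¹)) ^ 2 / (T.τ g + 2) - c * (T.τ y + T.τ (g * y⁻¹))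
        + (T.τ g + 2) - 4 + c ^ 2 := by
  have h1 := T.τ_mul_τ y (g * y⁻¹)
  have h2 := T.τ_mul_τ y y
  have h3 := T.τ_mul_τ (g * y⁻¹) (g * y⁻¹)
  have h4 := T.τ_mul_τ g (y * (g * y⁻¹)⁻¹)
  rw [mul_inv_cancel, T.τ_one] at h2 h3
  rw [show y * (g * y⁻¹) = g by rw [mul_comm g, mul_inv_cancel_left]] at h1
  rw [show g * (y * (g * y⁻¹)⁻¹) = y * y by
      rw [mul_inv, inv_inv, mul_left_comm y, mul_inv_cancel_left],
    show g * (y * (g * y⁻¹)⁻¹)⁻¹ = g * y⁻¹ * (g * y⁻¹) by simp [mul_comm, mul_left_comm]] at h4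
  have key : (T.τ y + T.τ (g * y⁻¹)) ^ 2
      = (T.τ g + 2) * (T.τ (y * (g * y⁻¹)⁻¹) + 2) := by
    linear_combination 2 * h1 + h2 + h3 - h4
  rw [key, mul_div_cancel_left₀ _ hg]
  linear_combination h1

theorem sum_quadraticChar_τ_sub_neg (T : TraceTorus F G) (hF : ringChar F ≠ 2) {c : F}
    (hc : c ≠ 0) (hc4 : c ^ 2 ≠ 4) :
    ∑ y, φ ((T.τ y - c) * (T.τ (T.neg * y⁻¹) - c))
      = - (1 + T.ε) * T.η hF T.neg
        + T.ε * ∑ z : F, φ (z * (2 - T.τ T.neg - z) * (4 - c ^ 2 - z)) := by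
  have h : ∀ y, φ ((T.τ y - c) * (T.τ (T.neg * y⁻¹) - c)) = φ (c ^ 2 - T.τ y ^ 2) := by
    intro y
    rw [T.τ_neg, T.τ_inv]
    congr 1
    ring
  have hq := sum_quadraticChar_quadratic hF (neg_ne_zero.2 (one_ne_zero (α := F)))
  have h1 : ∑ w : F, φ ((w ^ 2 - 4) * (c ^ 2 - w ^ 2))
      = -φ (-1) + ∑ z : F, φ (z * (2 - T.τ T.neg - z) * (4 - c ^ 2 - z)) := by
    rw [sum_comp_sq hF fun u => φ ((u - 4) * (c ^ 2 - u))]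
    simp only [add_mul, one_mul, Finset.sum_add_distrib, ← map_mul]
    congr 1
    · have := hq (c ^ 2 + 4) (-4 * c ^ 2)
      rw [if_neg fun h0 => (sub_ne_zero.2 hc4) (pow_eq_zero_iff two_ne_zero |>.1 (by
        linear_combination h0))] at this
      rw [← this]
      exact Finset.sum_congr rfl fun x _ => by congr 1; ring
    · refine Fintype.sum_equiv (Equiv.subLeft 4) _ _ fun u => ?_
      rw [T.τ_neg_self]
      congr 1
      simp
      ring
  simp only [h]
  rw [T.sum_τ hF fun w => φ (c ^ 2 - w ^ 2)]
  simp only [add_mul, one_mul, Finset.sum_add_distrib, mul_assoc, ← Finset.mul_sum]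
  simp only [← map_mul, ← mul_assoc]
  rw [h1, T.η_neg hF]
  have h2 := hq 0 (c ^ 2)
  have h4 : (4 : F) ≠ 0 := by
    rw [show (4 : F) = 2 * 2 by norm_num]
    exact mul_ne_zero (Ring.two_ne_zero hF) (Ring.two_ne_zero hF)
  rw [if_neg fun h0 => (mul_ne_zero h4 (pow_ne_zero 2 hc)) (by linear_combination h0)] at h2
  rw [show (∑ x : F, φ (c ^ 2 - x ^ 2)) = -φ (-1) from by
    rw [← h2]
    exact Finset.sum_congr rfl fun x _ => by congr 1; ring]
  linear_combination φ (-1) * T.ε_mul_self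

variable [DecidableEq G]

theorem η_eq (T : TraceTorus F G) (hF : ringChar F ≠ 2) (y : G) :
    T.η hF y = φ (T.τ y + 2) + if y = T.neg then T.ε * φ (-1) else 0 := by
  split_ifs with h
  · rw [h, T.η_neg hF, T.τ_neg_self]
    simp
  · rw [T.η_of_ne hF fun h' => h ((T.τ_eq_neg_two_iff hF).1 h'), add_zero]

theorem sum_η_mul (T : TraceTorus F G) (hF : ringChar F ≠ 2) (f : F → ℤ) :
    ∑ y, T.η hF y * f (T.τ y)
      = ∑ w, (φ (w + 2) + T.ε * φ (w - 2)) * f w := by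
  have h : ∀ y, T.η hF y * f (T.τ y)
      = φ (T.τ y + 2) * f (T.τ y) + if y = T.neg then T.ε * φ (-1) * f (-2) else 0 := by
    intro y
    rw [T.η_eq hF, add_mul, ite_mul, zero_mul]
    split_ifs with h
    · rw [h, T.τ_neg_self]
    · rfl
  simp only [h, Finset.sum_add_distrib, Finset.sum_ite_eq', Finset.mem_univ, if_true]
  rw [T.sum_τ hF fun w => φ (w + 2) * f w]
  have h' : ∀ w, (1 + T.ε * φ (w ^ 2 - 4)) * (φ (w + 2) * f w)
      = (φ (w + 2) + T.ε * φ (w - 2)) * f w - if w = -2 then T.ε * φ (-1) * f (-2) else 0 := by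
    intro w
    split_ifs with hw
    · have h4 : φ (-2 - 2) = φ (-1) := by
        rw [← quadraticChar_mul_sq (-1 : F) (Ring.two_ne_zero hF)]
        congr 1
        norm_num
      subst hw
      rw [h4, neg_add_cancel, MulChar.map_zero]
      ring
    · have hw' : w + 2 ≠ 0 := fun h => hw (by linear_combination h)
      rw [show w ^ 2 - 4 = (w - 2) * (w + 2) by ring, map_mul]
      linear_combination T.ε * φ (w - 2) * f w * quadraticChar_mul_self hw'
  simp only [h', Finset.sum_sub_distrib, Finset.sum_ite_eq', Finset.mem_univ, if_true]
  ring

theorem sum_η (T : TraceTorus F G) (hF : ringChar F ≠ 2) : ∑ y, T.η hF y = 0 := by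
  have h := T.sum_η_mul hF fun _ => 1
  simp only [mul_one, Finset.sum_add_distrib, ← Finset.mul_sum] at h
  have h1 := sum_quadraticChar_affine hF one_ne_zero (2 : F)
  have h2 := sum_quadraticChar_affine hF one_ne_zero (-2 : F)
  simp only [one_mul, ← sub_eq_add_neg] at h1 h2
  rw [h, h1, h2, mul_zero, add_zero]

theorem sum_quadraticChar_τ_sub_of_ne (T : TraceTorus F G) (hF : ringChar F ≠ 2) {c : F}
    (hc : c ≠ 0) (hc4 : c ^ 2 ≠ 4) {g : G} (hg : T.τ g ≠ -2) :
    ∑ y, φ ((T.τ y - c) * (T.τ (g * y⁻¹) - c))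
      = (if g = 1 then (Fintype.card F : ℤ) else 0) - (1 + T.ε) * T.η hF g
        + T.ε * ∑ z : F, φ (z * (2 - T.τ g - z) * (4 - c ^ 2 - z)) := by
  have hg' : T.τ g + 2 ≠ 0 := fun h => hg (by linear_combination h)
  set H := T.τ g + 2 with hH
  have hquad : ∀ X : F, φ (X ^ 2 / H - c * X + H - 4 + c ^ 2)
      = φ H * φ (X ^ 2 - c * H * X + H ^ 2 + (c ^ 2 - 4) * H) := by
    intro X
    rw [← map_mul, ← quadraticChar_mul_sq (X ^ 2 / H - c * X + H - 4 + c ^ 2) hg']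
    congr 1
    field_simp
    ring
  have h1 := sum_quadraticChar_quadratic hF one_ne_zero (-(c * H)) (H ^ 2 + (c ^ 2 - 4) * H)
  have h1' : ∑ X : F, φ (X ^ 2 - c * H * X + H ^ 2 + (c ^ 2 - 4) * H)
      = (if g = 1 then (Fintype.card F : ℤ) else 0) - 1 := by
    have hdisc : (-(c * H)) ^ 2 - 4 * 1 * (H ^ 2 + (c ^ 2 - 4) * H) = 0 ↔ g = 1 := by
      rw [← T.τ_eq_two_iff hF]
      constructor
      · intro h
        have h' : H * (c ^ 2 - 4) * (H - 4) = 0 := by linear_combination h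
        have := (mul_eq_zero.1 h').resolve_left (mul_ne_zero hg' (sub_ne_zero.2 hc4))
        linear_combination this
      · intro h
        rw [hH, h]
        ring
    simp only [hdisc] at h1
    simp only [map_one, mul_one] at h1
    rw [show (∑ X : F, φ (X ^ 2 - c * H * X + H ^ 2 + (c ^ 2 - 4) * H))
      = ∑ X : F, φ (1 * X ^ 2 + -(c * H) * X + (H ^ 2 + (c ^ 2 - 4) * H)) from
        Finset.sum_congr rfl fun X _ => by congr 1; ring, h1]
    split_ifs <;> ring
  have h2 := sum_quadraticChar_pencil hF hc hg'
  have h3 : φ H = T.η hF g := (T.η_of_ne hF hg).symm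
  have h4 := T.η_mul_self hF g
  have h5 : ∀ z : F, 4 - H - z = 2 - T.τ g - z := fun z => by rw [hH]; ring
  simp only [h5, h3] at h2
  have h6 : (if g = 1 then (Fintype.card F : ℤ) else 0) * T.η hF g
      = if g = 1 then (Fintype.card F : ℤ) else 0 := by
    split_ifs with h
    · rw [h, map_one, mul_one]
    · rw [zero_mul]
  simp only [T.τ_sub_mul_τ_sub hg', ← hH]
  rw [sum_comp_eq_sum_card_mul (fun y => T.τ y + T.τ (g * y⁻¹))
    fun X => φ (X ^ 2 / H - c * X + H - 4 + c ^ 2)]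
  simp only [T.card_fiber_add g _ hg, ← hH, hquad, h3]
  rw [show (∑ X : F, (1 + T.ε * φ (X ^ 2 - 4 * H)) *
        (T.η hF g * φ (X ^ 2 - c * H * X + H ^ 2 + (c ^ 2 - 4) * H)))
      = T.η hF g * (∑ X : F, φ (X ^ 2 - c * H * X + H ^ 2 + (c ^ 2 - 4) * H)
        + T.ε * ∑ X : F, φ ((X ^ 2 - 4 * H) *
          (X ^ 2 - c * H * X + H ^ 2 + (c ^ 2 - 4) * H))) from by
    simp only [Finset.mul_sum, ← Finset.sum_add_distrib, map_mul]
    exact Finset.sum_congr rfl fun X _ => by ring, h1', h2]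
  linear_combination h6 + T.ε * (∑ z : F, φ (z * (2 - T.τ g - z) * (4 - c ^ 2 - z))) * h4

theorem sum_quadraticChar_τ_sub (T : TraceTorus F G) (hF : ringChar F ≠ 2) {c : F}
    (hc : c ≠ 0) (hc4 : c ^ 2 ≠ 4) (g : G) :
    ∑ y, φ ((T.τ y - c) * (T.τ (g * y⁻¹) - c))
      = (if g = 1 then (Fintype.card F : ℤ) else 0) - (1 + T.ε) * T.η hF g
        + T.ε * ∑ z : F, φ (z * (2 - T.τ g - z) * (4 - c ^ 2 - z)) := by
  by_cases hg : T.τ g = -2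
  · have hn : T.neg ≠ 1 := fun h => by
      have h1 := T.τ_one
      rw [← h, T.τ_neg_self] at h1
      exact mul_ne_zero (Ring.two_ne_zero hF) (Ring.two_ne_zero hF) (by linear_combination -h1)
    rw [(T.τ_eq_neg_two_iff hF).1 hg, if_neg hn, T.sum_quadraticChar_τ_sub_neg hF hc hc4]
    ring
  · exact T.sum_quadraticChar_τ_sub_of_ne hF hc hc4 hg

/-- The spherical function of the trace torus attached to the character `χ`. -/
noncomputable def spherical (T : TraceTorus F G) (χ : G →* ℂ) (c : F) : ℂ :=
  ∑ y, χ y * φ (T.τ y - c)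

/-- The product formula for spherical functions of trace tori on the diagonal. -/
theorem spherical_sq (T : TraceTorus F G) (hF : ringChar F ≠ 2) {χ : G →* ℂ}
    (hχ : (1 + T.ε : ℂ) * ∑ y, χ y * T.η hF y = 0) {c : F} (hc : c ≠ 0) (hc4 : c ^ 2 ≠ 4) :
    T.spherical χ c ^ 2 = Fintype.card F
      + T.ε * χ T.neg * ∑ z : F, φ (z * (4 - c ^ 2 - z)) * T.spherical χ (z - 2) := by
  have h1 : T.spherical χ c ^ 2
      = ∑ g, χ g * ((∑ y, φ ((T.τ y - c) * (T.τ (g * y⁻¹) - c)) : ℤ) : ℂ) := by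
    rw [sq, spherical, Finset.sum_mul_sum]
    push_cast
    simp only [Finset.mul_sum]
    rw [Finset.sum_comm (f := fun g y =>
      χ g * ((φ ((T.τ y - c) * (T.τ (g * y⁻¹) - c)) : ℤ) : ℂ))]
    refine Finset.sum_congr rfl fun y _ => ?_
    refine Fintype.sum_equiv (Equiv.mulLeft y) _ _ fun z => ?_
    simp only [Equiv.coe_mulLeft, map_mul, mul_inv_cancel_comm, Int.cast_mul]
    ring
  have h2 : ∑ g, χ g * ∑ z : F, (φ (z * (2 - T.τ g - z) * (4 - c ^ 2 - z)) : ℂ)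
      = χ T.neg * ∑ z : F, φ (z * (4 - c ^ 2 - z)) * T.spherical χ (z - 2) := by
    simp only [Finset.mul_sum, spherical]
    rw [Finset.sum_comm]
    refine Finset.sum_congr rfl fun z _ => ?_
    refine Fintype.sum_equiv (Equiv.mulLeft T.neg) _ _ fun g => ?_
    have hn : χ T.neg * χ T.neg = 1 := by rw [← map_mul, T.neg_mul_neg hF, map_one]
    simp only [Equiv.coe_mulLeft, map_mul, T.τ_neg, Int.cast_mul]
    rw [show -T.τ g - (z - 2) = 2 - T.τ g - z by ring]
    linear_combination -(χ g * φ z * φ (2 - T.τ g - z) * φ (4 - c ^ 2 - z) : ℂ) * hn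
  have h0 : ∀ g (a b s : ℂ), χ g * (a - b + s) = χ g * a - χ g * b + χ g * s := fun g a b s => by
    ring
  rw [h1]
  simp only [T.sum_quadraticChar_τ_sub hF hc hc4]
  push_cast
  simp only [h0, Finset.sum_add_distrib, Finset.sum_sub_distrib]
  rw [mul_assoc (T.ε : ℂ), ← h2, Finset.mul_sum]
  have h3 : ∑ g, χ g * (if g = 1 then (Fintype.card F : ℂ) else 0) = Fintype.card F := by
    simp
  rw [h3]
  have h4 : ∑ g, χ g * ((1 + T.ε : ℂ) * T.η hF g) = 0 := by
    rw [← hχ, Finset.mul_sum]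
    exact Finset.sum_congr rfl fun g _ => by ring
  rw [h4, sub_zero]
  congr 1
  exact Finset.sum_congr rfl fun g _ => by ring

end TraceTorus

/-- The group of norm-one elements of the quadratic extension `F[√δ]`. -/
abbrev NormOneUnits {F : Type*} [Field F] (δ : F) : Subgroup (QuadraticAlgebra F δ 0)ˣ :=
  (Units.map (QuadraticAlgebra.norm : QuadraticAlgebra F δ 0 →* F)).ker

namespace NormOneUnits

variable {F : Type*} [Field F] {δ : F}

theorem norm_eq (y : NormOneUnits δ) : y.1.1.re ^ 2 - δ * y.1.1.im ^ 2 = 1 := by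
  have h := congrArg Units.val (MonoidHom.mem_ker.1 y.2)
  simp only [Units.coe_map, QuadraticAlgebra.norm_def, Units.val_one] at h
  linear_combination h

theorem val_inv (y : NormOneUnits δ) : (y.1⁻¹).1 = star y.1.1 := by
  have h : y.1.1 * star y.1.1 = 1 := by
    have := norm_eq y
    ext
    · simp [QuadraticAlgebra.re_one]
      linear_combination this
    · simp [QuadraticAlgebra.im_one]
      ring
  exact Units.inv_eq_of_mul_eq_one_right h

/-- The norm-one element `a + b√δ`. -/
def mk (a b : F) (h : a ^ 2 - δ * b ^ 2 = 1) : NormOneUnits δ :=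
  ⟨⟨⟨a, b⟩, ⟨a, -b⟩, by
      ext <;> simp [QuadraticAlgebra.re_one, QuadraticAlgebra.im_one]
      · linear_combination h
      · ring, by
      ext <;> simp [QuadraticAlgebra.re_one, QuadraticAlgebra.im_one]
      · linear_combination h
      · ring⟩, by
    rw [MonoidHom.mem_ker]
    ext
    simp [QuadraticAlgebra.norm_def]
    linear_combination h⟩

theorem ext' {y z : NormOneUnits δ} (h1 : y.1.1.re = z.1.1.re) (h2 : y.1.1.im = z.1.1.im) :
    y = z :=
  Subtype.ext (Units.ext (QuadraticAlgebra.ext h1 h2))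

instance [Fintype F] : Finite (NormOneUnits δ) :=
  Finite.of_injective (fun y : NormOneUnits δ => (y.1.1.re, y.1.1.im)) fun _ _ h =>
    ext' (congrArg Prod.fst h) (congrArg Prod.snd h)

theorem isCyclic [Fintype F] (hδ : ¬ IsSquare δ) : IsCyclic (NormOneUnits δ) := by
  have : Fact (∀ r : F, r ^ 2 ≠ δ + 0 * r) := ⟨fun r h => hδ ⟨r, by linear_combination -h⟩⟩
  infer_instance

noncomputable instance [Fintype F] : Fintype (NormOneUnits δ) := Fintype.ofFinite _

end NormOneUnits

section Tori

variable {F : Type*} [Field F] [Fintype F] [DecidableEq F]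

local notation "φ" => quadraticChar F

/-- The split rank-one torus `Fˣ` with trace `y + y⁻¹`. -/
def splitTorus (hF : ringChar F ≠ 2) : TraceTorus F Fˣ where
  ε := 1
  ε_eq := Or.inl rfl
  τ y := y + (y⁻¹ : Fˣ)
  neg := -1
  τ_one := by norm_num
  τ_mul_τ y z := by
    push_cast
    field_simp
    ring
  τ_neg y := by
    simp
    ring
  card_fiber_add g X hg := by
    have hg0 : (g : F) ≠ 0 := g.ne_zero
    have hg1 : 1 + (g : F) ≠ 0 := fun h => hg (by
      have : (g : F) = -1 := by linear_combination h
      push_cast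
      rw [this]
      norm_num)
    have hg2 : 1 + (g : F)⁻¹ ≠ 0 := fun h => hg1 (by
      field_simp at h
      linear_combination h)
    have h := card_quadratic_eq hF hg2 (-X) (1 + (g : F))
    rw [one_mul]
    convert h using 3
    · refine Finset.card_bij' (fun y _ => (y : F)) (fun x hx => Units.mk0 x ?_) ?_ ?_ ?_ ?_
      · rintro rfl
        simp [hg1] at hx
      · intro y hy
        simp only [Finset.mem_filter, Finset.mem_univ, true_and] at hy ⊢
        rw [← hy]
        push_cast
        field_simp
        ring
      · intro x hx
        have hx0 : x ≠ 0 := by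
          rintro rfl
          simp [hg1] at hx
        simp only [Finset.mem_filter, Finset.mem_univ, true_and] at hx ⊢
        push_cast
        simp only [Units.val_mk0]
        field_simp
        field_simp at hx
        linear_combination hx
      · intro y _
        simp
      · intro y _
        simp
    · push_cast
      field_simp
      ring

/-- The nonsplit rank-one torus of norm-one elements of `F[√δ]`, with trace `y + y⁻¹`. -/
noncomputable def nonsplitTorus (hF : ringChar F ≠ 2) {δ : F} (hδ : quadraticChar F δ = -1) :
    TraceTorus F (NormOneUnits δ) where
  ε := -1
  ε_eq := Or.inr rfl
  τ y := 2 * y.1.1.re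
  neg := NormOneUnits.mk (-1) 0 (by ring)
  τ_one := by simp [QuadraticAlgebra.re_one]
  τ_mul_τ y z := by
    simp [NormOneUnits.val_inv]
    ring
  τ_neg y := by
    simp [NormOneUnits.mk]
  card_fiber_add g X hg := by
    have h2 : (2 : F) ≠ 0 := Ring.two_ne_zero hF
    have hδ0 : δ ≠ 0 := by
      rintro rfl
      simp at hδ
    have hg1 := NormOneUnits.norm_eq g
    have hg2 : 1 + g.1.1.re ≠ 0 := fun h => hg (by linear_combination 2 * h)
    have h := card_sq_eq hF ((X ^ 2 - 4 * (2 * g.1.1.re + 2)) * δ * (2 * δ)⁻¹ ^ 2)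
    rw [quadraticChar_mul_sq _ (inv_ne_zero (mul_ne_zero h2 hδ0)), map_mul, hδ] at h
    rw [neg_one_mul, ← mul_neg_one, ← h, Nat.cast_inj]
    set m := g.1.1.re with hm
    set n := g.1.1.im with hn
    have hH : 2 * (1 + m) ≠ 0 := mul_ne_zero h2 hg2
    have hmem : ∀ v, v ^ 2 = (X ^ 2 - 4 * (2 * m + 2)) * δ * (2 * δ)⁻¹ ^ 2 →
        4 * δ * v ^ 2 = X ^ 2 - 8 * (1 + m) := fun v hv => by
      rw [hv]
      field_simp
      ring
    refine Finset.card_bij' (fun y _ => y.1.1.im * (1 + m) - y.1.1.re * n)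
      (fun v hv => NormOneUnits.mk ((X / 2 * (1 + m) + δ * n * v) / (2 * (1 + m)))
        ((X / 2 * n + v * (1 + m)) / (2 * (1 + m))) ?_) ?_ ?_ ?_ ?_
    · have hv := hmem v (by simpa using hv)
      field_simp
      linear_combination (δ * n ^ 2 - (1 + m) ^ 2) * hv + 8 * (1 + m) * hg1
    · intro y hy
      have hy1 := NormOneUnits.norm_eq y
      simp only [Finset.mem_filter, Finset.mem_univ, true_and, NormOneUnits.val_inv,
        Subgroup.coe_mul, Subgroup.coe_inv, Units.val_mul, QuadraticAlgebra.re_mul,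
        QuadraticAlgebra.re_star, QuadraticAlgebra.im_star, ← hm, ← hn] at hy ⊢
      rw [← hy]
      field_simp
      linear_combination -2 * ((1 + m) ^ 2 - δ * n ^ 2) * hy1 - 2 * hg1
    · intro v hv
      simp only [Finset.mem_filter, Finset.mem_univ, true_and, NormOneUnits.val_inv,
        Subgroup.coe_mul, Subgroup.coe_inv, Units.val_mul, QuadraticAlgebra.re_mul,
        QuadraticAlgebra.re_star, QuadraticAlgebra.im_star, NormOneUnits.mk] at hv ⊢
      field_simp
      linear_combination X * hg1
    · intro y hy
      simp only [Finset.mem_filter, Finset.mem_univ, true_and, NormOneUnits.val_inv,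
        Subgroup.coe_mul, Subgroup.coe_inv, Units.val_mul, QuadraticAlgebra.re_mul,
        QuadraticAlgebra.re_star, QuadraticAlgebra.im_star, ← hm, ← hn] at hy
      refine NormOneUnits.ext' ?_ ?_
      · simp only [NormOneUnits.mk]
        rw [← hy]
        field_simp
        linear_combination y.1.1.re * hg1
      · simp only [NormOneUnits.mk]
        rw [← hy]
        field_simp
        linear_combination y.1.1.im * hg1
    · intro v hv
      simp only [NormOneUnits.mk]
      field_simp
      linear_combination 2 * v * hg1

theorem exists_traceTorus {F : Type} [Field F] [Fintype F] [DecidableEq F]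
    (hF : ringChar F ≠ 2) {ε : ℤ} (hε : ε = 1 ∨ ε = -1) :
    ∃ (G : Type) (_ : CommGroup G) (_ : Fintype G) (_ : IsCyclic G) (T : TraceTorus F G),
      T.ε = ε := by
  rcases hε with rfl | rfl
  · exact ⟨Fˣ, inferInstance, inferInstance, inferInstance, splitTorus hF, rfl⟩
  · obtain ⟨δ, hδ⟩ := quadraticChar_exists_neg_one hF
    exact ⟨NormOneUnits δ, inferInstance, inferInstance,
      NormOneUnits.isCyclic (quadraticChar_neg_one_iff_not_isSquare.1 hδ), nonsplitTorus hF hδ, rfl⟩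

end Tori

section CyclicCharacters

variable {G : Type*} [CommGroup G] [Fintype G]

theorem exists_isPrimitiveRoot_apply {γ : G} (hγ : ∀ y, y ∈ Submonoid.powers γ) {k : ℕ}
    (hk : k ≠ 0) (hkG : k ∣ Fintype.card G) :
    ∃ χ : G →* ℂ, IsPrimitiveRoot (χ γ) k := by
  have hζ := Complex.isPrimitiveRoot_exp k hk
  have hγ' : ∀ y, y ∈ Subgroup.zpowers γ := fun y => Submonoid.powers_le_zpowers _ (hγ y)
  have ho : orderOf (hζ.isUnit hk).unit ∣ orderOf γ := by
    rw [orderOf_eq_card_of_forall_mem_zpowers hγ', Nat.card_eq_fintype_card]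
    rw [← orderOf_units, IsUnit.unit_spec, ← hζ.eq_orderOf]
    exact hkG
  refine ⟨(Units.coeHom ℂ).comp (monoidHomOfForallMemZpowers hγ' ho), ?_⟩
  simpa using hζ

theorem card_pow_eq_sum [DecidableEq G] {γ : G} (hγ : ∀ y, y ∈ Submonoid.powers γ) {k : ℕ}
    (hkG : k ∣ Fintype.card G) {χ : G →* ℂ} (hχ : IsPrimitiveRoot (χ γ) k) (y : G) :
    ((Finset.univ.filter fun z => z ^ k = y).card : ℂ) = ∑ i ∈ Finset.range k, χ y ^ i := by
  have hγ' : ∀ y, y ∈ Subgroup.zpowers γ := fun y => Submonoid.powers_le_zpowers _ (hγ y)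
  have hcyc : IsCyclic G := ⟨γ, hγ'⟩
  obtain ⟨m, rfl⟩ := hγ y
  simp only [map_pow]
  by_cases hm : k ∣ m
  · obtain ⟨j, rfl⟩ := hm
    have h1 : (χ γ) ^ (k * j) = 1 := by rw [pow_mul, hχ.pow_eq_one, one_pow]
    have h2 : (Finset.univ.filter fun z : G => z ^ k = γ ^ (k * j)).card
        = (Finset.univ.filter fun z : G => z ^ k = 1).card := by
      refine Finset.card_equiv (Equiv.mulRight (γ ^ j)⁻¹) fun z => ?_
      simp only [Finset.mem_filter, Finset.mem_univ, true_and, Equiv.coe_mulRight, mul_pow,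
        inv_pow, ← pow_mul, mul_inv_eq_one, mul_comm j k]
    have h3 : (Finset.univ.filter fun z : G => z ^ k = 1).card = k := by
      have h := IsCyclic.card_powMonoidHom_ker G k
      rw [Nat.card_eq_fintype_card (α := G), Nat.gcd_eq_right hkG] at h
      exact (Nat.subtype_card _ fun z => by simp [MonoidHom.mem_ker]).symm.trans h
    rw [h2, h3]
    simp [h1]
  · have h1 : (χ γ) ^ m ≠ 1 := fun h => hm ((hχ.pow_eq_one_iff_dvd m).1 h)
    rw [geom_sum_eq h1, ← pow_mul, mul_comm, pow_mul, hχ.pow_eq_one, one_pow, sub_self, zero_div,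
      Nat.cast_eq_zero, Finset.card_eq_zero, Finset.filter_eq_empty_iff]
    intro z _ hz
    have := congrArg χ hz
    rw [map_pow, map_pow] at this
    obtain ⟨j, rfl⟩ := hγ z
    rw [map_pow, ← pow_mul, mul_comm, pow_mul, hχ.pow_eq_one, one_pow] at this
    exact h1 this.symm

theorem sum_comp_pow {γ : G} (hγ : ∀ y, y ∈ Submonoid.powers γ) {k : ℕ}
    (hkG : k ∣ Fintype.card G) {χ : G →* ℂ} (hχ : IsPrimitiveRoot (χ γ) k)
    (f : G → ℂ) :
    ∑ z, f (z ^ k) = ∑ y, (∑ i ∈ Finset.range k, χ y ^ i) * f y := by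
  classical
  rw [sum_comp_eq_sum_card_mul (fun z => z ^ k) f]
  exact Finset.sum_congr rfl fun y _ => by rw [card_pow_eq_sum hγ hkG hχ]

end CyclicCharacters

/-- The functional equation `h(t)² = q - ∑ₓ φ(x(x - 4t(1-t))) h(x)` behind Clausen's formula. -/
def IsClausenKernel {F : Type*} [Field F] [Fintype F] [DecidableEq F] (h : F → ℤ) : Prop :=
  ∀ t, t ≠ 0 → t ≠ 1 → 2 * t ≠ 1 →
    h t ^ 2 = Fintype.card F - ∑ x, quadraticChar F (x * (x - 4 * t * (1 - t))) * h x

namespace TraceTorus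

variable {F G : Type*} [Field F] [Fintype F] [DecidableEq F] [CommGroup G] [Fintype G]

local notation "φ" => quadraticChar F

theorem τ_pow_two (T : TraceTorus F G) (z : G) : T.τ (z ^ 2) = T.τ z ^ 2 - 2 := by
  have h := T.τ_mul_τ z z
  rw [mul_inv_cancel, T.τ_one] at h
  rw [sq z]
  linear_combination -h

theorem τ_pow_three (T : TraceTorus F G) (z : G) :
    T.τ (z ^ 3) = T.τ z ^ 3 - 3 * T.τ z := by
  have h := T.τ_mul_τ (z ^ 2) z
  rw [T.τ_pow_two, ← pow_succ, pow_two z, mul_inv_cancel_right] at h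
  linear_combination -h

/-- The quadratic character of the torus with values in `ℂ`. -/
def ηC (T : TraceTorus F G) (hF : ringChar F ≠ 2) : G →* ℂ :=
  (Int.castRingHom ℂ : ℤ →* ℂ).comp (T.η hF)

theorem ηC_apply (T : TraceTorus F G) (hF : ringChar F ≠ 2) (y : G) :
    T.ηC hF y = T.η hF y := rfl

theorem spherical_inv (T : TraceTorus F G) {χ χ' : G →* ℂ} (h : ∀ y, χ' y = χ y⁻¹) (c : F) :
    T.spherical χ' c = T.spherical χ c :=
  Fintype.sum_equiv (Equiv.inv G) _ _ fun y => by rw [Equiv.inv_apply, h, T.τ_inv]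

variable [DecidableEq G]

theorem isClausenKernel (T : TraceTorus F G) (hF : ringChar F ≠ 2) {χ : G →* ℂ}
    (hχ : (1 + T.ε : ℂ) = 0 ∨ χ * T.ηC hF ≠ 1) {κ : ℤ}
    (hκ : (κ : ℂ) = -T.ε * φ (-1) * χ T.neg) {h : F → ℤ}
    (hh : ∀ x, x ≠ 0 → (h x : ℂ) = κ * T.spherical χ (4 * x - 2)) : IsClausenKernel h := by
  intro t ht0 ht1 ht2
  have h2 : (2 : F) ≠ 0 := Ring.two_ne_zero hF
  have h4 : (4 : F) ≠ 0 := by rw [show (4 : F) = 2 * 2 by norm_num]; exact mul_ne_zero h2 h2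
  have hχ' : (1 + T.ε : ℂ) * ∑ y, χ y * T.η hF y = 0 := by
    rcases hχ with h0 | h0
    · rw [h0, zero_mul]
    · rw [show ∑ y, χ y * (T.η hF y : ℂ) = ∑ y, (χ * T.ηC hF) y from rfl,
        sum_hom_units_eq_zero _ h0, mul_zero]
  have hc : 4 * t - 2 ≠ 0 := fun h => ht2 (by
    have : 2 * (2 * t - 1) = 0 := by linear_combination h
    linear_combination (mul_eq_zero.1 this).resolve_left h2)
  have hc4 : (4 * t - 2) ^ 2 ≠ 4 := fun h => by
    have : 4 * 4 * (t * (t - 1)) = 0 := by linear_combination h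
    exact mul_ne_zero (mul_ne_zero h4 h4) (mul_ne_zero ht0 (sub_ne_zero.2 ht1)) this
  have hs := T.spherical_sq hF hχ' hc hc4
  have hn : χ T.neg * χ T.neg = 1 := by rw [← map_mul, T.neg_mul_neg hF, map_one]
  have hε : (T.ε : ℂ) * T.ε = 1 := by exact_mod_cast T.ε_mul_self
  have hm : (φ (-1) : ℂ) * φ (-1) = 1 := by
    rw [← Int.cast_mul, quadraticChar_mul_self (neg_ne_zero.2 one_ne_zero), Int.cast_one]
  have hsum : ∑ z : F, (φ (z * (4 - (4 * t - 2) ^ 2 - z)) : ℂ) * T.spherical χ (z - 2)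
      = φ (-1) * ∑ x : F, (φ (x * (x - 4 * t * (1 - t))) : ℂ) * T.spherical χ (4 * x - 2) := by
    rw [Finset.mul_sum]
    symm
    refine Fintype.sum_equiv (Equiv.mulLeft₀ 4 h4) _ _ fun x => ?_
    rw [Equiv.mulLeft₀_apply, show 4 * x * (4 - (4 * t - 2) ^ 2 - 4 * x)
      = -1 * (x * (x - 4 * t * (1 - t))) * 4 ^ 2 by ring, quadraticChar_mul_sq _ h4, map_mul (φ) (-1)]
    push_cast
    ring
  have hsum2 : ∑ x : F, (φ (x * (x - 4 * t * (1 - t))) : ℂ) * h x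
      = κ * ∑ x : F, (φ (x * (x - 4 * t * (1 - t))) : ℂ) * T.spherical χ (4 * x - 2) := by
    rw [Finset.mul_sum]
    refine Finset.sum_congr rfl fun x _ => ?_
    rcases eq_or_ne x 0 with rfl | hx
    · simp
    · rw [hh x hx]
      ring
  rw [hsum] at hs
  rw [← Int.cast_inj (α := ℂ)]
  push_cast
  have hκ2 : (κ : ℂ) ^ 2 = 1 := by
    rw [hκ]
    linear_combination (T.ε : ℂ) * T.ε * φ (-1) * φ (-1) * hn + (T.ε : ℂ) * T.ε * hm + hε
  rw [hsum2, hh t ht0, mul_pow, hs]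
  set S := ∑ x : F, (φ (x * (x - 4 * t * (1 - t))) : ℂ) * T.spherical χ (4 * x - 2)
  linear_combination (Fintype.card F + T.ε * χ T.neg * (φ (-1) * S)) * hκ2 + S * hκ

end TraceTorus

section ClausenKernels

variable {F : Type} [Field F] [Fintype F] [DecidableEq F]

local notation "φ" => quadraticChar F

open Classical in
theorem isClausenKernel_two (hF : ringChar F ≠ 2) {h : F → ℤ}
    (hh : ∀ x, x ≠ 0 → h x = -φ (-1) * ∑ w, φ ((w ^ 2 - 4) * (w - (4 * x - 2)))) :
    IsClausenKernel h := by
  obtain ⟨G, _, _, _, T, hT⟩ := exists_traceTorus hF (Or.inl rfl)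
  refine T.isClausenKernel hF (χ := 1) (κ := -φ (-1)) (Or.inr fun h0 => ?_) ?_ fun x hx => ?_
  · rw [one_mul] at h0
    have h1 := T.sum_η hF
    have h2 : ∀ y, T.η hF y = 1 := fun y => by
      have := DFunLike.congr_fun h0 y
      rw [T.ηC_apply, MonoidHom.one_apply] at this
      exact_mod_cast this
    simp [h2] at h1
  · rw [hT]
    simp
  · have h1 : ∑ y, φ (T.τ y - (4 * x - 2)) = ∑ w, φ ((w ^ 2 - 4) * (w - (4 * x - 2))) := by
      have h0 := sum_quadraticChar_affine hF one_ne_zero (-(4 * x - 2))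
      simp only [one_mul, ← sub_eq_add_neg] at h0
      rw [T.sum_τ hF fun w => φ (w - (4 * x - 2))]
      simp only [hT, one_mul, add_mul, Finset.sum_add_distrib, map_mul, h0, zero_add]
    rw [hh x hx, ← h1, TraceTorus.spherical]
    push_cast
    simp

open Classical in
theorem isClausenKernel_four (hF : ringChar F ≠ 2) {h : F → ℤ}
    (hh : ∀ x, x ≠ 0 → h x = -φ 2 * ∑ w, φ (w + 2) * φ (w ^ 2 - 2 - (4 * x - 2))) :
    IsClausenKernel h := by
  have hq := FiniteField.odd_card_of_char_ne_two hF
  obtain ⟨ε, hε, hqε⟩ : ∃ ε : ℤ, (ε = 1 ∨ ε = -1) ∧ (4 : ℤ) ∣ Fintype.card F - ε := by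
    rcases (by omega : Fintype.card F % 4 = 1 ∨ Fintype.card F % 4 = 3) with h | h
    · exact ⟨1, Or.inl rfl, by omega⟩
    · exact ⟨-1, Or.inr rfl, by omega⟩
  obtain ⟨G, _, _, hG, T, hT⟩ := exists_traceTorus hF hε
  have h4G : 4 ∣ Fintype.card G := by
    have := T.card_eq hF
    rw [hT] at this
    omega
  obtain ⟨γ, hγ⟩ := IsCyclic.exists_monoid_generator (α := G)
  obtain ⟨χ, hχ⟩ := exists_isPrimitiveRoot_apply hγ four_ne_zero h4G
  have hχ2 : (χ γ) ^ 2 = -1 := by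
    have h1 : ((χ γ) ^ 2 - 1) * ((χ γ) ^ 2 + 1) = 0 := by linear_combination hχ.pow_eq_one
    have h2 : (χ γ) ^ 2 ≠ 1 := hχ.pow_ne_one_of_pos_of_lt two_ne_zero (by norm_num)
    linear_combination (mul_eq_zero.1 h1).resolve_left (sub_ne_zero.2 h2)
  have hη : ∀ y, χ y ^ 2 = T.η hF y := by
    have h1 : T.η hF γ = -1 := by
      rcases mul_self_eq_one_iff.1 (T.η_mul_self hF γ) with h1 | h1
      · have h2 : ∀ y, T.η hF y = 1 := fun y => by
          obtain ⟨m, rfl⟩ := hγ y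
          simp [h1]
        have h3 := T.sum_η hF
        simp [h2] at h3
      · exact h1
    intro y
    obtain ⟨m, rfl⟩ := hγ y
    simp only [map_pow, h1]
    rw [← pow_mul, mul_comm, pow_mul, hχ2]
    push_cast
    rfl
  have hη1 : (T.ε : ℤ) * φ (-1) = 1 := by
    have h1 := hη T.neg
    rw [sq, ← map_mul, T.neg_mul_neg hF, map_one, T.η_neg hF] at h1
    exact_mod_cast h1.symm
  have h2 : (2 : F) ≠ 0 := Ring.two_ne_zero hF
  have hneg : χ T.neg = φ 2 := by
    have hc := T.card_fiber hF 0
    rw [show (0 ^ 2 - 4 : F) = -1 * 2 ^ 2 by norm_num, quadraticChar_mul_sq _ h2, hη1] at hc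
    obtain ⟨z, hz⟩ : (Finset.univ.filter fun y => T.τ y = 0).Nonempty := by
      rw [← Finset.card_pos]
      omega
    have hz : T.τ z = 0 := by simpa using hz
    have hz2 : z ^ 2 = T.neg := by
      rw [← T.τ_eq_neg_two_iff hF, T.τ_pow_two, hz]
      ring
    rw [← hz2, map_pow, hη, T.η_of_ne hF, hz, zero_add]
    rw [hz]
    exact fun h => h2 (by linear_combination h)
  refine T.isClausenKernel hF (χ := χ) (κ := -φ 2) (Or.inr fun h0 => ?_) ?_ fun x hx => ?_
  · have h1 := DFunLike.congr_fun h0 γ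
    rw [MonoidHom.mul_apply, T.ηC_apply, ← hη, MonoidHom.one_apply, hχ2] at h1
    have h2 : (χ γ) ^ 2 ≠ 1 := hχ.pow_ne_one_of_pos_of_lt two_ne_zero (by norm_num)
    exact h2 (by linear_combination (1 - χ γ) * h1)
  · have : (T.ε : ℂ) * φ (-1) = 1 := by exact_mod_cast hη1
    rw [hneg]
    push_cast
    linear_combination (φ 2 : ℂ) * this
  · set c := 4 * x - 2
    have h1 : ∑ z, T.η hF z * φ (T.τ z ^ 2 - 2 - c) = 2 * ∑ w, φ (w + 2) * φ (w ^ 2 - 2 - c) := by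
      rw [T.sum_η_mul hF fun w => φ (w ^ 2 - 2 - c), two_mul]
      simp only [add_mul, Finset.sum_add_distrib]
      congr 1
      refine Fintype.sum_equiv (Equiv.neg F) _ _ fun w => ?_
      rw [Equiv.neg_apply, show w - 2 = -1 * (-w + 2) by ring, map_mul (φ) (-1), neg_sq]
      linear_combination φ (-w + 2) * φ (w ^ 2 - 2 - c) * hη1
    have h3 : ∑ z, T.η hF z * (φ (T.τ z ^ 2 - 2 - c) : ℂ) = 2 * T.spherical χ c := by
      have hs := sum_comp_pow hγ (k := 2) (dvd_trans (by norm_num) h4G) (χ := χ ^ 2) (by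
        rw [MonoidHom.pow_apply, hχ2]
        exact IsPrimitiveRoot.neg_one 0 (by norm_num)) fun y => χ y * (φ (T.τ y - c) : ℂ)
      simp only [map_pow, hη, T.τ_pow_two] at hs
      rw [hs, two_mul]
      nth_rw 2 [← T.spherical_inv (χ' := χ ^ 3) (χ := χ)]
      · simp only [TraceTorus.spherical, ← Finset.sum_add_distrib]
        refine Finset.sum_congr rfl fun y _ => ?_
        simp only [MonoidHom.pow_apply, Finset.sum_range_succ, Finset.sum_range_zero]
        ring
      · intro y
        have h5 : χ y * χ y⁻¹ = 1 := by rw [← map_mul, mul_inv_cancel, map_one]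
        have h6 : χ y ^ 4 = 1 := by
          rw [show 4 = 2 * 2 from rfl, pow_mul, hη, sq]
          exact_mod_cast T.η_mul_self hF y
        rw [MonoidHom.pow_apply]
        linear_combination χ y⁻¹ * h6 - χ y ^ 3 * h5
    have h4 : T.spherical χ c = ∑ w, (φ (w + 2) * φ (w ^ 2 - 2 - c) : ℤ) := by
      have h5 : (2 : ℂ) * T.spherical χ c = 2 * ∑ w, (φ (w + 2) * φ (w ^ 2 - 2 - c) : ℤ) := by
        rw [← h3]
        exact_mod_cast h1
      exact mul_left_cancel₀ two_ne_zero h5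
    rw [hh x hx, h4]
    push_cast
    rfl

theorem exists_cubic_traceTorus (hF : ringChar F ≠ 2) (h3 : ¬ 3 ∣ Fintype.card F)
    (h3F : (3 : F) ≠ 0) :
    ∃ (G G' : Type) (_ : CommGroup G) (_ : Fintype G) (_ : CommGroup G') (_ : Fintype G')
      (T : TraceTorus F G) (T' : TraceTorus F G') (χ : G →* ℂ),
      T'.ε = -T.ε ∧ φ (-3) = T.ε ∧ χ ≠ 1 ∧ (∀ y, χ y ^ 3 = 1) ∧
      (∀ f : G → ℂ, ∑ z, f (z ^ 3) = ∑ y, (1 + χ y + χ y ^ 2) * f y) ∧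
      (∀ f : G' → ℂ, ∑ z, f (z ^ 3) = ∑ y, f y) := by
  obtain ⟨ε, hε, hqε⟩ : ∃ ε : ℤ, (ε = 1 ∨ ε = -1) ∧ (3 : ℤ) ∣ Fintype.card F - ε := by
    rcases (by omega : Fintype.card F % 3 = 1 ∨ Fintype.card F % 3 = 2) with h | h
    · exact ⟨1, Or.inl rfl, by omega⟩
    · exact ⟨-1, Or.inr rfl, by omega⟩
  obtain ⟨G, _, _, _, T, hT⟩ := exists_traceTorus hF hε
  obtain ⟨G', _, _, _, T', hT'⟩ := exists_traceTorus hF (ε := -ε) (by omega)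
  have h3G : 3 ∣ Fintype.card G := by
    have := T.card_eq hF
    rw [hT] at this
    omega
  have h3G' : (Nat.card G').Coprime 3 := by
    have := T'.card_eq hF
    rw [hT'] at this
    rw [Nat.card_eq_fintype_card, Nat.coprime_comm, Nat.Prime.coprime_iff_not_dvd Nat.prime_three]
    omega
  obtain ⟨γ, hγ⟩ := IsCyclic.exists_monoid_generator (α := G)
  obtain ⟨χ, hχ⟩ := exists_isPrimitiveRoot_apply hγ three_ne_zero h3G
  refine ⟨G, G', _, _, _, _, T, T', χ, by rw [hT, hT'], ?_, ?_, ?_, ?_, ?_⟩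
  · obtain ⟨w, hw⟩ := exists_prime_orderOf_dvd_card 3 h3G
    have hw1 : T.τ w ≠ 2 := fun h => by
      rw [T.τ_eq_two_iff hF] at h
      simp [h] at hw
    have hw3 := T.τ_pow_three w
    rw [show w ^ 3 = 1 from hw ▸ pow_orderOf_eq_one w, T.τ_one] at hw3
    have hw2 : T.τ w = -1 := by
      have : (T.τ w - 2) * (T.τ w + 1) ^ 2 = 0 := by linear_combination -hw3
      linear_combination pow_eq_zero_iff two_ne_zero |>.1
        ((mul_eq_zero.1 this).resolve_left (sub_ne_zero.2 hw1))
    have := T.quadraticChar_τ_sq_sub_four hF (y := w) (by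
      rw [hw2]
      exact fun h => h3F (by linear_combination -h))
    rw [← this, hw2]
    norm_num
  · rintro rfl
    exact hχ.ne_one (by norm_num) rfl
  · intro y
    obtain ⟨m, rfl⟩ := hγ y
    rw [map_pow, ← pow_mul, mul_comm, pow_mul, hχ.pow_eq_one, one_pow]
  · intro f
    rw [sum_comp_pow hγ h3G hχ]
    simp [Finset.sum_range_succ]
  · intro f
    exact Fintype.sum_equiv (powCoprime h3G') _ _ fun z => rfl

theorem TraceTorus.sum_τ_add {G G' : Type*} [CommGroup G] [Fintype G] [CommGroup G'] [Fintype G']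
    {T : TraceTorus F G} {T' : TraceTorus F G'} (hF : ringChar F ≠ 2) (hT : T'.ε = -T.ε)
    (f : F → ℤ) : ∑ y, f (T.τ y) + ∑ y, f (T'.τ y) = 2 * ∑ w, f w := by
  rw [T.sum_τ hF, T'.sum_τ hF, ← Finset.sum_add_distrib, Finset.mul_sum, hT]
  exact Finset.sum_congr rfl fun w _ => by ring

theorem TraceTorus.sum_η_mul_add {G G' : Type*} [CommGroup G] [Fintype G] [CommGroup G']
    [Fintype G'] [DecidableEq G] [DecidableEq G']
    {T : TraceTorus F G} {T' : TraceTorus F G'} (hF : ringChar F ≠ 2) (hT : T'.ε = -T.ε)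
    (f : F → ℤ) :
    ∑ y, T.η hF y * f (T.τ y) + ∑ y, T'.η hF y * f (T'.τ y) = 2 * ∑ w, φ (w + 2) * f w := by
  rw [T.sum_η_mul hF, T'.sum_η_mul hF, ← Finset.sum_add_distrib, Finset.mul_sum, hT]
  exact Finset.sum_congr rfl fun w _ => by ring

theorem TraceTorus.apply_neg_of_pow_three {G : Type*} [CommGroup G] [Fintype G]
    (T : TraceTorus F G) (hF : ringChar F ≠ 2) {χ : G →* ℂ} (hχ : ∀ y, χ y ^ 3 = 1) :
    χ T.neg = 1 := by
  have h1 : χ T.neg * χ T.neg = 1 := by rw [← map_mul, T.neg_mul_neg hF, map_one]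
  linear_combination hχ T.neg - χ T.neg * h1

theorem inv_apply_of_pow_three {G : Type*} [CommGroup G] {χ : G →* ℂ}
    (hχ : ∀ y, χ y ^ 3 = 1) (y : G) : χ y⁻¹ = χ y ^ 2 := by
  have h1 : χ y * χ y⁻¹ = 1 := by rw [← map_mul, mul_inv_cancel, map_one]
  linear_combination χ y ^ 2 * h1 - χ y⁻¹ * hχ y

open Classical in
theorem isClausenKernel_six (hF : ringChar F ≠ 2) (h3 : ¬ 3 ∣ Fintype.card F)
    (h3F : (3 : F) ≠ 0) {h : F → ℤ}
    (hh : ∀ x, x ≠ 0 → h x = -φ 3 * ∑ v, φ (v ^ 3 - 3 * v - (4 * x - 2))) :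
    IsClausenKernel h := by
  obtain ⟨G, G', _, _, _, _, T, T', χ, hTT', hT3, hχ, hχ3, hs, hs'⟩ :=
    exists_cubic_traceTorus hF h3 h3F
  refine T.isClausenKernel hF (χ := χ) (κ := -φ 3) (Or.inr fun h0 => hχ ?_) ?_ fun x hx => ?_
  · ext y
    have h1 := DFunLike.congr_fun h0 y
    rw [MonoidHom.mul_apply, T.ηC_apply, MonoidHom.one_apply] at h1
    have h2 : (T.η hF y : ℂ) * T.η hF y = 1 := by exact_mod_cast T.η_mul_self hF y
    rw [MonoidHom.one_apply]
    linear_combination hχ3 y - χ y * (χ y * T.η hF y + 1) * h1 + χ y ^ 3 * h2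
  · rw [T.apply_neg_of_pow_three hF hχ3, ← hT3, show (-3 : F) = 3 * -1 by ring, map_mul]
    have : (φ (-1) : ℂ) * φ (-1) = 1 := by
      rw [← Int.cast_mul, quadraticChar_mul_self (neg_ne_zero.2 one_ne_zero), Int.cast_one]
    push_cast
    linear_combination (φ 3 : ℂ) * this
  · set c := 4 * x - 2
    have h1 := TraceTorus.sum_τ_add hF hTT' fun v => φ (v ^ 3 - 3 * v - c)
    have h2 := TraceTorus.sum_τ_add hF hTT' fun v => φ (v - c)
    have h0 := sum_quadraticChar_affine hF one_ne_zero (-c)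
    simp only [one_mul, ← sub_eq_add_neg] at h0
    rw [h0] at h2
    have h4 := hs fun y => (φ (T.τ y - c) : ℂ)
    have h5 := hs' fun y => (φ (T'.τ y - c) : ℂ)
    simp only [TraceTorus.τ_pow_three, add_mul, one_mul, Finset.sum_add_distrib] at h4 h5
    have h6 := T.spherical_inv (χ := χ) (χ' := χ ^ 2) (fun y => by
      rw [inv_apply_of_pow_three hχ3, MonoidHom.pow_apply]) c
    simp only [TraceTorus.spherical, MonoidHom.pow_apply] at h6
    rw [h6] at h4
    have h7 : (∑ y, χ y * (φ (T.τ y - c) : ℂ)) = (∑ v, φ (v ^ 3 - 3 * v - c) : ℤ) := by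
      replace h1 := congrArg (Int.cast (R := ℂ)) h1
      replace h2 := congrArg (Int.cast (R := ℂ)) h2
      push_cast at h1 h2 ⊢
      linear_combination (h1 - h2 - h4 - h5) / 2
    rw [hh x hx, TraceTorus.spherical, h7]
    push_cast
    rfl

open Classical in
theorem isClausenKernel_three (hF : ringChar F ≠ 2) (h3 : ¬ 3 ∣ Fintype.card F)
    (h3F : (3 : F) ≠ 0) {h : F → ℤ}
    (hh : ∀ x, x ≠ 0 → h x = -1 - ∑ v, φ (v + 2) * φ (v ^ 3 - 3 * v - (4 * x - 2))) :
    IsClausenKernel h := by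
  obtain ⟨G, G', _, _, _, _, T, T', χ, hTT', hT3, hχ, hχ3, hs, hs'⟩ :=
    exists_cubic_traceTorus hF h3 h3F
  have hηη : ∀ y, (T.η hF y : ℂ) * T.η hF y = 1 := fun y => by
    exact_mod_cast T.η_mul_self hF y
  refine T.isClausenKernel hF (χ := χ * T.ηC hF) (κ := -1) (Or.inr fun h0 => hχ ?_) ?_
    fun x hx => ?_
  · ext y
    have h1 := DFunLike.congr_fun h0 y
    rw [MonoidHom.mul_apply, MonoidHom.mul_apply, T.ηC_apply, MonoidHom.one_apply] at h1
    rw [MonoidHom.one_apply]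
    linear_combination h1 - χ y * hηη y
  · rw [MonoidHom.mul_apply, T.apply_neg_of_pow_three hF hχ3, T.ηC_apply, T.η_neg hF]
    have h1 : (φ (-1) : ℂ) * φ (-1) = 1 := by
      rw [← Int.cast_mul, quadraticChar_mul_self (neg_ne_zero.2 one_ne_zero), Int.cast_one]
    have h2 : (T.ε : ℂ) * T.ε = 1 := by exact_mod_cast T.ε_mul_self
    push_cast
    linear_combination h2 + (T.ε : ℂ) * T.ε * h1
  · set c := 4 * x - 2 with hc
    have h4F : (4 : F) ≠ 0 := by
      rw [show (4 : F) = 2 * 2 by norm_num]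
      exact mul_ne_zero (Ring.two_ne_zero hF) (Ring.two_ne_zero hF)
    have h1 := TraceTorus.sum_η_mul_add hF hTT' fun v => φ (v ^ 3 - 3 * v - c)
    have h2 := TraceTorus.sum_η_mul_add hF hTT' fun v => φ (v - c)
    have h0 := sum_quadraticChar_quadratic hF one_ne_zero (2 - c) (-2 * c)
    rw [if_neg (fun h => by
      have : (4 * x) ^ 2 = 0 := by rw [hc] at h; linear_combination h
      exact mul_ne_zero h4F hx (pow_eq_zero_iff two_ne_zero |>.1 this)), map_one] at h0
    have h0' : ∑ v, φ (v + 2) * φ (v - c) = -1 := by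
      rw [← h0]
      exact Finset.sum_congr rfl fun v _ => by rw [← map_mul]; congr 1; ring
    rw [h0'] at h2
    have h3η : ∀ {G : Type} [CommGroup G] [Fintype G] (T : TraceTorus F G) (y : G),
        T.η hF y ^ 3 = T.η hF y := fun T y => by
      rw [pow_succ, sq, T.η_mul_self, one_mul]
    have h4 := hs fun y => T.η hF y * (φ (T.τ y - c) : ℂ)
    have h5 := hs' fun y => T'.η hF y * (φ (T'.τ y - c) : ℂ)
    simp only [TraceTorus.τ_pow_three, map_pow, h3η, add_mul, one_mul,
      Finset.sum_add_distrib] at h4 h5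
    have h6 := T.spherical_inv (χ := χ * T.ηC hF) (χ' := χ ^ 2 * T.ηC hF) (fun y => by
      have h7 : T.η hF y⁻¹ = T.η hF y := T.ηFun_inv y
      rw [MonoidHom.mul_apply, MonoidHom.mul_apply, inv_apply_of_pow_three hχ3,
        MonoidHom.pow_apply, T.ηC_apply, T.ηC_apply, h7]) c
    simp only [TraceTorus.spherical, MonoidHom.mul_apply, MonoidHom.pow_apply, T.ηC_apply,
      mul_assoc] at h6
    rw [h6] at h4
    have h7 : (∑ y, χ y * (T.η hF y * (φ (T.τ y - c) : ℂ)))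
        = (1 + ∑ v, φ (v + 2) * φ (v ^ 3 - 3 * v - c) : ℤ) := by
      replace h1 := congrArg (Int.cast (R := ℂ)) h1
      replace h2 := congrArg (Int.cast (R := ℂ)) h2
      push_cast at h1 h2 ⊢
      linear_combination (h1 - h2 - h4 - h5) / 2
    simp only [TraceTorus.spherical, MonoidHom.mul_apply, T.ηC_apply, mul_assoc]
    rw [hh x hx, h7]
    push_cast
    ring

end ClausenKernels

section CharacterSums

variable {p : ℕ} [Fact p.Prime]

theorem sum_units_eq_sum_sub {R : Type*} [AddCommGroup R] (f : ZMod p → R) :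
    ∑ u : (ZMod p)ˣ, f u = ∑ x, f x - f 0 := by
  rw [eq_sub_iff_add_eq', ← Finset.add_sum_erase _ f (Finset.mem_univ 0),
    Finset.sum_subtype (p := fun x => x ≠ 0) (Finset.univ.erase 0) (by simp) f]
  congr 1
  exact Fintype.sum_equiv unitsEquivNeZero _ _ fun _ => rfl

theorem sum_mulChar_apply (a : ZMod p) :
    ∑ χ : MulChar (ZMod p) ℂ, χ a = if a = 1 then (p : ℂ) - 1 else 0 := by
  have h := DirichletCharacter.sum_characters_eq ℂ a
  rw [Nat.totient_prime Fact.out, Nat.cast_sub (Fact.out : p.Prime).one_le, Nat.cast_one] at h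
  exact h

theorem sum_units_mulChar (χ : MulChar (ZMod p) ℂ) :
    ∑ u : (ZMod p)ˣ, χ u = if χ = 1 then (p : ℂ) - 1 else 0 := by
  rw [sum_units_eq_sum_sub (fun x => χ x), MulChar.map_zero, sub_zero]
  split_ifs with h
  · rw [h, MulChar.sum_one_eq_card_units, ZMod.card_units_eq_totient,
      Nat.totient_prime Fact.out, Nat.cast_sub (Fact.out : p.Prime).one_le, Nat.cast_one]
  · exact MulChar.sum_eq_zero_of_ne_one h

theorem gaussSum_eq_sum_units (χ : MulChar (ZMod p) ℂ) (ψ : AddChar (ZMod p) ℂ) :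
    gaussSum χ ψ = ∑ u : (ZMod p)ˣ, χ u * ψ u := by
  rw [sum_units_eq_sum_sub (fun x => χ x * ψ x), MulChar.map_zero, zero_mul, sub_zero, gaussSum]

theorem sum_units_addChar_mul {ψ : AddChar (ZMod p) ℂ} (hψ : ψ ≠ 1) (c : ZMod p) :
    ∑ u : (ZMod p)ˣ, ψ (u * c) = p * (if c = 0 then 1 else 0) - 1 := by
  rw [sum_units_eq_sum_sub (fun x => ψ (x * c)),
    AddChar.sum_mulShift c (AddChar.IsPrimitive.of_ne_one hψ)]
  simp [ZMod.card]

theorem inv_pow_apply_units (χ : MulChar (ZMod p) ℂ) (n : ℕ) (u : (ZMod p)ˣ) :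
    (χ ^ n)⁻¹ (u : ZMod p) = χ ((u⁻¹ ^ n : (ZMod p)ˣ) : ZMod p) := by
  rw [MulChar.inv_apply, Ring.inverse_unit, MulChar.pow_apply_coe, Units.val_pow_eq_pow_val, map_pow]

theorem pow_apply_units (χ : MulChar (ZMod p) ℂ) (n : ℕ) (u : (ZMod p)ˣ) :
    (χ ^ n) (u : ZMod p) = χ ((u ^ n : (ZMod p)ˣ) : ZMod p) := by
  rw [MulChar.pow_apply_coe, Units.val_pow_eq_pow_val, map_pow]

theorem sum_gaussSum_mul_three {ψ : AddChar (ZMod p) ℂ} (hψ : ψ ≠ 1) (a b : ℕ) (t : (ZMod p)ˣ) :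
    ∑ χ : MulChar (ZMod p) ℂ, gaussSum (χ ^ (a + b + 1)) ψ * (gaussSum (χ ^ a)⁻¹ ψ *
      (gaussSum (χ ^ b)⁻¹ ψ * gaussSum (χ ^ 1)⁻¹ ψ)) * χ t =
    (p - 1) * ∑ x : (ZMod p)ˣ, ∑ y : (ZMod p)ˣ,
      ((p : ℂ) * (if (1 + x + y + t * (x⁻¹ ^ a * y⁻¹ ^ b : (ZMod p)ˣ) : ZMod p) = 0 then 1 else 0)
        - 1) := by
  have key : ∀ χ : MulChar (ZMod p) ℂ, gaussSum (χ ^ (a + b + 1)) ψ * (gaussSum (χ ^ a)⁻¹ ψ *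
      (gaussSum (χ ^ b)⁻¹ ψ * gaussSum (χ ^ 1)⁻¹ ψ)) * χ t =
      ∑ z : (ZMod p)ˣ, ∑ x : (ZMod p)ˣ, ∑ y : (ZMod p)ˣ, ∑ w : (ZMod p)ˣ,
        χ ((t * (z ^ (a + b + 1) * x⁻¹ ^ a * y⁻¹ ^ b * w⁻¹) : (ZMod p)ˣ) : ZMod p) *
          ψ (z + x + y + w) := by
    intro χ
    simp only [gaussSum_eq_sum_units]
    rw [Finset.sum_mul_sum, Finset.sum_mul_sum, Finset.sum_mul_sum, Finset.sum_mul]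
    simp only [Finset.mul_sum, Finset.sum_mul]
    refine Finset.sum_congr rfl fun z _ => Finset.sum_congr rfl fun x _ =>
      Finset.sum_congr rfl fun y _ => Finset.sum_congr rfl fun w _ => ?_
    simp only [inv_pow_apply_units, pow_apply_units, AddChar.map_add_eq_mul, Units.val_mul,
      map_mul]
    simp only [pow_one]
    ring
  simp only [key]
  rw [Finset.sum_comm]
  simp only [Finset.sum_comm (s := (Finset.univ : Finset (MulChar (ZMod p) ℂ))),
    ← Finset.sum_mul, sum_mulChar_apply, Units.val_eq_one]
  have inner : ∀ z x y : (ZMod p)ˣ, ∑ w : (ZMod p)ˣ,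
      (if t * (z ^ (a + b + 1) * x⁻¹ ^ a * y⁻¹ ^ b * w⁻¹) = 1 then (p : ℂ) - 1 else 0) *
        ψ (z + x + y + w) =
      (p - 1) * ψ (z + x + y + (t * (z ^ (a + b + 1) * x⁻¹ ^ a * y⁻¹ ^ b) : (ZMod p)ˣ)) := by
    intro z x y
    rw [Finset.sum_eq_single (t * (z ^ (a + b + 1) * x⁻¹ ^ a * y⁻¹ ^ b))]
    · rw [if_pos (by group)]
    · intro w _ hw
      rw [if_neg, zero_mul]
      contrapose hw
      rw [← mul_assoc, mul_inv_eq_one] at hw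
      exact hw.symm
    · exact fun h => absurd (Finset.mem_univ _) h
  simp only [inner]
  have shift : ∀ z : (ZMod p)ˣ, ∑ x : (ZMod p)ˣ, ∑ y : (ZMod p)ˣ,
      ((p : ℂ) - 1) * ψ (z + x + y + (t * (z ^ (a + b + 1) * x⁻¹ ^ a * y⁻¹ ^ b) : (ZMod p)ˣ)) =
      ∑ x : (ZMod p)ˣ, ∑ y : (ZMod p)ˣ,
        ((p : ℂ) - 1) * ψ (z * (1 + x + y + t * (x⁻¹ ^ a * y⁻¹ ^ b : (ZMod p)ˣ))) := by
    intro z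
    refine (Fintype.sum_equiv (Equiv.mulLeft z) _ _ fun x =>
      Fintype.sum_equiv (Equiv.mulLeft z) _ _ fun y => ?_).symm
    congr 2
    simp only [Equiv.coe_mulLeft, mul_inv, mul_pow, inv_pow, Units.val_mul, Units.val_pow_eq_pow_val,
      Units.val_inv_eq_inv_val, mul_add, mul_one]
    have hz : (z : ZMod p) ≠ 0 := z.ne_zero
    field_simp
    ring
  simp only [shift]
  rw [Finset.sum_comm, Finset.mul_sum]
  refine Finset.sum_congr rfl fun x _ => ?_
  rw [Finset.sum_comm, Finset.mul_sum]
  refine Finset.sum_congr rfl fun y _ => ?_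
  rw [← Finset.mul_sum, sum_units_addChar_mul hψ]

theorem sum_gaussSum_mul_two {ψ : AddChar (ZMod p) ℂ} (hψ : ψ ≠ 1) (t : (ZMod p)ˣ) :
    ∑ χ : MulChar (ZMod p) ℂ, gaussSum (χ ^ 2) ψ * (gaussSum (χ ^ 1)⁻¹ ψ *
      gaussSum (χ ^ 1)⁻¹ ψ) * χ t =
    (p - 1) * ∑ x : (ZMod p)ˣ,
      ((p : ℂ) * (if (1 + x + t * (x⁻¹ : (ZMod p)ˣ) : ZMod p) = 0 then 1 else 0) - 1) := by
  have key : ∀ χ : MulChar (ZMod p) ℂ, gaussSum (χ ^ 2) ψ * (gaussSum (χ ^ 1)⁻¹ ψ *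
      gaussSum (χ ^ 1)⁻¹ ψ) * χ t =
      ∑ z : (ZMod p)ˣ, ∑ x : (ZMod p)ˣ, ∑ w : (ZMod p)ˣ,
        χ ((t * (z ^ 2 * x⁻¹ * w⁻¹) : (ZMod p)ˣ) : ZMod p) * ψ (z + x + w) := by
    intro χ
    simp only [gaussSum_eq_sum_units]
    rw [Finset.sum_mul_sum, Finset.sum_mul_sum, Finset.sum_mul]
    simp only [Finset.mul_sum, Finset.sum_mul]
    refine Finset.sum_congr rfl fun z _ => Finset.sum_congr rfl fun x _ =>
      Finset.sum_congr rfl fun w _ => ?_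
    simp only [inv_pow_apply_units, pow_apply_units, AddChar.map_add_eq_mul, Units.val_mul,
      map_mul]
    simp only [pow_one]
    ring
  simp only [key]
  rw [Finset.sum_comm]
  simp only [Finset.sum_comm (s := (Finset.univ : Finset (MulChar (ZMod p) ℂ))),
    ← Finset.sum_mul, sum_mulChar_apply, Units.val_eq_one]
  have inner : ∀ z x : (ZMod p)ˣ, ∑ w : (ZMod p)ˣ,
      (if t * (z ^ 2 * x⁻¹ * w⁻¹) = 1 then (p : ℂ) - 1 else 0) * ψ (z + x + w) =
      (p - 1) * ψ (z + x + (t * (z ^ 2 * x⁻¹) : (ZMod p)ˣ)) := by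
    intro z x
    rw [Finset.sum_eq_single (t * (z ^ 2 * x⁻¹))]
    · rw [if_pos (by group)]
    · intro w _ hw
      rw [if_neg, zero_mul]
      contrapose hw
      rw [← mul_assoc, mul_inv_eq_one] at hw
      exact hw.symm
    · exact fun h => absurd (Finset.mem_univ _) h
  simp only [inner]
  have shift : ∀ z : (ZMod p)ˣ, ∑ x : (ZMod p)ˣ,
      ((p : ℂ) - 1) * ψ (z + x + (t * (z ^ 2 * x⁻¹) : (ZMod p)ˣ)) =
      ∑ x : (ZMod p)ˣ, ((p : ℂ) - 1) * ψ (z * (1 + x + t * (x⁻¹ : (ZMod p)ˣ))) := by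
    intro z
    refine (Fintype.sum_equiv (Equiv.mulLeft z) _ _ fun x => ?_).symm
    congr 2
    simp only [Equiv.coe_mulLeft, mul_inv, Units.val_mul, Units.val_pow_eq_pow_val,
      Units.val_inv_eq_inv_val, mul_add, mul_one]
    have hz : (z : ZMod p) ≠ 0 := z.ne_zero
    field_simp
  simp only [shift]
  rw [Finset.sum_comm, Finset.mul_sum]
  refine Finset.sum_congr rfl fun x _ => ?_
  rw [← Finset.mul_sum, sum_units_addChar_mul hψ]

theorem mellin_inversion {c : MulChar (ZMod p) ℂ → ℂ} {f : (ZMod p)ˣ → ℂ}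
    (h : ∀ u : (ZMod p)ˣ, ∑ χ, c χ * χ u = (p - 1) * f u) (χ : MulChar (ZMod p) ℂ) :
    ∑ u : (ZMod p)ˣ, f u * χ⁻¹ u = c χ := by
  have hp : (p : ℂ) - 1 ≠ 0 := sub_ne_zero.2 (by exact_mod_cast (Fact.out : p.Prime).one_lt.ne')
  apply mul_left_cancel₀ hp
  rw [Finset.mul_sum]
  simp only [← mul_assoc, ← h, Finset.sum_mul]
  rw [Finset.sum_comm]
  have : ∀ η : MulChar (ZMod p) ℂ, ∑ u : (ZMod p)ˣ, c η * η u * χ⁻¹ u =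
      c η * if η = χ then (p : ℂ) - 1 else 0 := by
    intro η
    simp only [mul_assoc, ← MulChar.mul_apply]
    rw [← Finset.mul_sum, sum_units_mulChar]
    simp only [mul_inv_eq_one]
  simp only [this]
  simp [mul_comm]

theorem mellin_convolution {c₁ c₂ : MulChar (ZMod p) ℂ → ℂ} {f₁ f₂ : (ZMod p)ˣ → ℂ}
    (h₁ : ∀ u : (ZMod p)ˣ, ∑ χ, c₁ χ * χ u = (p - 1) * f₁ u)
    (h₂ : ∀ u : (ZMod p)ˣ, ∑ χ, c₂ χ * χ u = (p - 1) * f₂ u) (t : (ZMod p)ˣ) :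
    ∑ χ, c₁ χ * c₂ χ * χ t = (p - 1) * ∑ u : (ZMod p)ˣ, f₁ u * f₂ (t * u⁻¹) := by
  simp only [← mellin_inversion h₁, Finset.sum_mul]
  rw [Finset.sum_comm, Finset.mul_sum]
  refine Finset.sum_congr rfl fun u _ => ?_
  rw [mul_left_comm, ← h₂, Finset.mul_sum]
  refine Finset.sum_congr rfl fun χ _ => ?_
  rw [MulChar.inv_apply, Ring.inverse_unit, Units.val_mul, map_mul]
  ring

end CharacterSums

section HypergeometricCoefficients

variable {p : ℕ} [Fact p.Prime]

open Classical in
/-- The multiplicity of the character `χ` in the greatest common divisor of the numerator and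
denominator attached to the lists `P` and `Q`. -/
noncomputable def charMultiplicity (P Q : List ℕ) (χ : MulChar (ZMod p) ℂ) : ℕ :=
  min (P.countP fun a => decide (χ ^ a = 1)) (Q.countP fun a => decide (χ ^ a = 1))

/-- The coefficient of `χ` in the Beukers–Cohen–Mellit sum. -/
noncomputable def bcmCoeff (ψ : AddChar (ZMod p) ℂ) (P Q : List ℕ) (χ : MulChar (ZMod p) ℂ) : ℂ :=
  (p : ℂ) ^ charMultiplicity P Q χ / (p : ℂ) ^ charMultiplicity P Q (1 : MulChar (ZMod p) ℂ) *
    (P.map fun j => gaussSum (χ ^ j) ψ).prod * (Q.map fun q => gaussSum (χ ^ q)⁻¹ ψ).prod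

theorem sum_range_pow_eq_sum_mulChar {ω : MulChar (ZMod p) ℂ} (hω : orderOf ω = p - 1)
    (f : MulChar (ZMod p) ℂ → ℂ) : ∑ m ∈ Finset.range (p - 1), f (ω ^ m) = ∑ χ, f χ := by
  classical
  have hcard : Fintype.card (MulChar (ZMod p) ℂ) = p - 1 := by
    rw [← Nat.card_eq_fintype_card, ← Nat.totient_prime (Fact.out : p.Prime)]
    exact DirichletCharacter.card_eq_totient_of_hasEnoughRootsOfUnity ℂ p
  have hinj : Set.InjOn (ω ^ · : ℕ → MulChar (ZMod p) ℂ) (Finset.range (p - 1)) := by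
    rw [Finset.coe_range, ← hω]
    exact pow_injOn_Iio_orderOf
  rw [← Finset.sum_image (f := f) hinj]
  congr 1
  apply Finset.eq_univ_of_card
  rw [Finset.card_image_of_injOn hinj, hcard, Finset.card_range]

theorem BCM_eq_sum_bcmCoeff (ψ : AddChar (ZMod p) ℂ) {ω : MulChar (ZMod p) ℂ}
    (hω : orderOf ω = p - 1) (P Q : List ℕ) (N : ℤ) (t : ZMod p) :
    BCM p ψ ω P Q N t = (-1 : ℂ) ^ (P.length + Q.length) / (1 - (p : ℂ)) *
      ∑ χ, bcmCoeff ψ P Q χ * χ ((N : ZMod p)⁻¹ * t) := by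
  rw [← sum_range_pow_eq_sum_mulChar hω]
  have hs : ∀ (m : ℕ) (l : List ℕ), (l.countP fun a => decide ((p - 1) ∣ m * a)) =
      l.countP fun a => @decide ((ω ^ m) ^ a = 1) (Classical.propDecidable _) := by
    intro m l
    congr 1
    ext a
    rw [decide_eq_decide, ← hω, orderOf_dvd_iff_pow_eq_one, pow_mul]
  simp only [BCM, bcmCoeff, charMultiplicity, hs, pow_mul, pow_zero]
  congr!

theorem bcmCoeff_one {ψ : AddChar (ZMod p) ℂ} (hψ : ψ ≠ 1) (P Q : List ℕ) :
    bcmCoeff ψ P Q 1 = (-1) ^ (P.length + Q.length) := by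
  have hp : (p : ℂ) ≠ 0 := Nat.cast_ne_zero.2 (Fact.out : p.Prime).ne_zero
  simp [bcmCoeff, gaussSum_one_left hψ, pow_add, hp]

theorem gaussSum_mul_gaussSum_inv {ψ : AddChar (ZMod p) ℂ} (hψ : ψ ≠ 1)
    {χ : MulChar (ZMod p) ℂ} (hχ : χ ≠ 1) : gaussSum χ ψ * gaussSum χ⁻¹ ψ = χ (-1) * p := by
  have h := gaussSum_mul_gaussSum_eq_card hχ (AddChar.IsPrimitive.of_ne_one hψ)
  rw [ZMod.card] at h
  have h' := mul_gaussSum_inv_eq_gaussSum χ⁻¹ ψ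
  rw [← h, ← h', MulChar.inv_apply']
  simp only [inv_neg, inv_one]
  ring

theorem sq_apply_neg_one (χ : MulChar (ZMod p) ℂ) : (χ ^ 2) (-1) = 1 := by
  rw [MulChar.pow_apply' _ two_ne_zero, ← map_pow]
  simp

theorem bcmCoeff_two_two {ψ : AddChar (ZMod p) ℂ} (hψ : ψ ≠ 1) (χ : MulChar (ZMod p) ℂ) :
    bcmCoeff ψ [2, 2] [1, 1, 1, 1] χ = bcmCoeff ψ [2] [1, 1] χ * bcmCoeff ψ [2] [1, 1] χ := by
  by_cases h1 : χ = 1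
  · simp [h1, bcmCoeff_one hψ]
    norm_num
  have hp : (p : ℂ) ≠ 0 := Nat.cast_ne_zero.2 (Fact.out : p.Prime).ne_zero
  simp [bcmCoeff, charMultiplicity, List.countP_cons, h1]
  field_simp

theorem bcmCoeff_two_two_two {ψ : AddChar (ZMod p) ℂ} (hψ : ψ ≠ 1) (χ : MulChar (ZMod p) ℂ) :
    bcmCoeff ψ [2, 2, 2] [1, 1, 1, 1, 1, 1] χ =
      bcmCoeff ψ [2] [1, 1] χ * bcmCoeff ψ [2, 2] [1, 1, 1, 1] χ := by
  by_cases h1 : χ = 1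
  · simp [h1, bcmCoeff_one hψ]
    norm_num
  have hp : (p : ℂ) ≠ 0 := Nat.cast_ne_zero.2 (Fact.out : p.Prime).ne_zero
  simp [bcmCoeff, charMultiplicity, List.countP_cons, h1]
  field_simp

theorem bcmCoeff_two_three {ψ : AddChar (ZMod p) ℂ} (hψ : ψ ≠ 1) (χ : MulChar (ZMod p) ℂ) :
    bcmCoeff ψ [2, 3] [1, 1, 1, 1, 1] χ =
      bcmCoeff ψ [2] [1, 1] χ * bcmCoeff ψ [3] [1, 1, 1] χ := by
  by_cases h1 : χ = 1
  · simp [h1, bcmCoeff_one hψ]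
    norm_num
  have hp : (p : ℂ) ≠ 0 := Nat.cast_ne_zero.2 (Fact.out : p.Prime).ne_zero
  simp [bcmCoeff, charMultiplicity, List.countP_cons, h1]
  field_simp

theorem bcmCoeff_four {ψ : AddChar (ZMod p) ℂ} (hψ : ψ ≠ 1) (χ : MulChar (ZMod p) ℂ) :
    bcmCoeff ψ [4] [1, 1, 1, 1] χ =
      bcmCoeff ψ [2] [1, 1] χ * bcmCoeff ψ [4] [2, 1, 1] χ := by
  by_cases h1 : χ = 1
  · simp [h1, bcmCoeff_one hψ]
    norm_num
  have hp : (p : ℂ) ≠ 0 := Nat.cast_ne_zero.2 (Fact.out : p.Prime).ne_zero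
  by_cases h2 : χ ^ 2 = 1
  · have h4 : χ ^ 4 = 1 := by rw [pow_mul χ 2 2, h2, one_pow]
    simp [bcmCoeff, charMultiplicity, h1, h2, h4, gaussSum_one_left hψ]
    field_simp
  · have h := gaussSum_mul_gaussSum_inv hψ h2
    rw [sq_apply_neg_one, one_mul] at h
    simp [bcmCoeff, charMultiplicity, List.countP_cons, h1, h2]
    field_simp
    rw [← h]
    ring

theorem bcmCoeff_six {ψ : AddChar (ZMod p) ℂ} (hψ : ψ ≠ 1) (χ : MulChar (ZMod p) ℂ) :
    bcmCoeff ψ [6] [3, 1, 1, 1] χ =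
      bcmCoeff ψ [2] [1, 1] χ * bcmCoeff ψ [6] [3, 2, 1] χ := by
  by_cases h1 : χ = 1
  · simp [h1, bcmCoeff_one hψ]
    norm_num
  have hp : (p : ℂ) ≠ 0 := Nat.cast_ne_zero.2 (Fact.out : p.Prime).ne_zero
  by_cases h2 : χ ^ 2 = 1
  · have h6 : χ ^ 6 = 1 := by rw [pow_mul χ 2 3, h2, one_pow]
    have h3 : χ ^ 3 = χ := by rw [pow_succ, h2, one_mul]
    simp [bcmCoeff, charMultiplicity, h1, h2, h3, h6, gaussSum_one_left hψ]
    field_simp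
  · have h := gaussSum_mul_gaussSum_inv hψ h2
    rw [sq_apply_neg_one, one_mul] at h
    simp [bcmCoeff, charMultiplicity, List.countP_cons, h1, h2]
    by_cases h3 : χ ^ 3 = 1
    · have h6 : χ ^ 6 = 1 := by rw [pow_mul χ 3 2, h3, one_pow]
      simp [h3, h6]
      field_simp
      rw [← h]
      ring
    · simp [h3]
      field_simp
      rw [← h]
      ring

end HypergeometricCoefficients

section HypergeometricTransforms

variable {p : ℕ} [Fact p.Prime]

local notation "φ" => quadraticChar (ZMod p)

theorem sum_units_pow_mul_eq_one (n : ℕ) (u : (ZMod p)ˣ) :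
    ∑ χ : MulChar (ZMod p) ℂ, (if χ ^ n = 1 then χ u else 0) =
      ∑ x : (ZMod p)ˣ, if x ^ n = u then 1 else 0 := by
  have hp : (p : ℂ) - 1 ≠ 0 := sub_ne_zero.2 (by exact_mod_cast (Fact.out : p.Prime).one_lt.ne')
  have h : ∀ χ : MulChar (ZMod p) ℂ, ((p : ℂ) - 1) * (if χ ^ n = 1 then χ u else 0) =
      ∑ x : (ZMod p)ˣ, χ ((u * (x⁻¹ ^ n) : (ZMod p)ˣ) : ZMod p) := by
    intro χ
    have := sum_units_mulChar (χ ^ n)⁻¹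
    simp only [inv_pow_apply_units, inv_eq_one] at this
    simp only [Units.val_mul _ (_ ^ n), map_mul, ← Finset.mul_sum, this]
    split_ifs <;> ring
  apply mul_left_cancel₀ hp
  rw [Finset.mul_sum, Finset.sum_congr rfl fun χ _ => h χ, Finset.sum_comm, Finset.mul_sum]
  refine Finset.sum_congr rfl fun x _ => ?_
  rw [sum_mulChar_apply]
  simp only [Units.val_eq_one, inv_pow, mul_inv_eq_one, eq_comm (a := u)]
  split_ifs <;> ring

theorem sum_units_ite_eq {f : ZMod p → ZMod p} {g : ℤ} (h0 : f 0 ≠ 0)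
    (hg : ((Finset.univ.filter fun x => f x = 0).card : ℤ) = g) :
    ∑ x : (ZMod p)ˣ, (if f x = 0 then (1 : ℂ) else 0) = (g : ℂ) := by
  rw [sum_units_eq_sum_sub (fun x => if f x = 0 then (1 : ℂ) else 0), if_neg h0, sub_zero, ← hg,
    Finset.sum_boole]
  simp

theorem sum_units_quadratic (hF : ringChar (ZMod p) ≠ 2) (a b c : ZMod p) (ha : a ≠ 0)
    (hc : c ≠ 0) :
    ∑ x : (ZMod p)ˣ, (if a * (x : ZMod p) ^ 2 + b * x + c = 0 then (1 : ℂ) else 0) =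
      ((1 + φ (b ^ 2 - 4 * a * c) : ℤ) : ℂ) :=
  sum_units_ite_eq (f := fun x => a * x ^ 2 + b * x + c) (by simpa using hc)
    (card_quadratic_eq hF ha b c)

theorem card_units_cast : (Fintype.card (ZMod p)ˣ : ℂ) = p - 1 := by
  rw [ZMod.card_units_eq_totient, Nat.totient_prime Fact.out,
    Nat.cast_sub (Fact.out : p.Prime).one_le, Nat.cast_one]

theorem sum_bcmCoeff_two (hF : ringChar (ZMod p) ≠ 2) {ψ : AddChar (ZMod p) ℂ} (hψ : ψ ≠ 1)
    (u : (ZMod p)ˣ) :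
    ∑ χ, bcmCoeff ψ [2] [1, 1] χ * χ u = (p - 1) * ((φ (1 - 4 * u) : ℤ) : ℂ) := by
  have hp : (p : ℂ) ≠ 0 := Nat.cast_ne_zero.2 (Fact.out : p.Prime).ne_zero
  have h : ∀ χ : MulChar (ZMod p) ℂ, bcmCoeff ψ [2] [1, 1] χ * χ u =
      (p : ℂ)⁻¹ * (gaussSum (χ ^ 2) ψ * (gaussSum (χ ^ 1)⁻¹ ψ * gaussSum (χ ^ 1)⁻¹ ψ) * χ u) +
        if χ = 1 then -(1 - (p : ℂ)⁻¹) else 0 := by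
    intro χ
    by_cases h1 : χ = 1
    · simp [h1, bcmCoeff_one hψ, gaussSum_one_left hψ]
      ring
    · simp [bcmCoeff, charMultiplicity, h1]
      ring
  have hcount : ∑ x : (ZMod p)ˣ,
      (if (1 + x + u * (x⁻¹ : (ZMod p)ˣ) : ZMod p) = 0 then (1 : ℂ) else 0) =
      ((1 + φ (1 - 4 * u) : ℤ) : ℂ) := by
    rw [← one_pow (M := ZMod p) 2, ← mul_one (4 : ZMod p),
      ← sum_units_quadratic hF 1 1 u one_ne_zero u.ne_zero]
    refine Finset.sum_congr rfl fun x _ => if_congr ?_ rfl rfl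
    have hx : (x : ZMod p) ≠ 0 := x.ne_zero
    rw [Units.val_inv_eq_inv_val, ← mul_left_inj' hx, zero_mul]
    refine Eq.congr ?_ rfl
    field_simp
    ring
  simp only [h]
  rw [Finset.sum_add_distrib, ← Finset.mul_sum, sum_gaussSum_mul_two hψ, Finset.sum_sub_distrib,
    ← Finset.mul_sum, hcount, Finset.sum_ite_eq' _ _ _, if_pos (Finset.mem_univ _),
    Finset.sum_const, Finset.card_univ, nsmul_one, card_units_cast]
  push_cast
  field_simp
  ring

theorem sum_units_torus (hF : ringChar (ZMod p) ≠ 2) (a : ℕ) (u : (ZMod p)ˣ) :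
    ∑ x : (ZMod p)ˣ, ∑ y : (ZMod p)ˣ,
      (if (1 + x + y + u * (x⁻¹ ^ a * y⁻¹ ^ 1 : (ZMod p)ˣ) : ZMod p) = 0 then (1 : ℂ) else 0) =
    p - 1 + ∑ x : (ZMod p)ˣ,
      ((φ ((x : ZMod p) ^ (2 * a) * (1 + x) ^ 2 - 4 * x ^ a * u) : ℤ) : ℂ) := by
  have h : ∀ x : (ZMod p)ˣ, ∑ y : (ZMod p)ˣ,
      (if (1 + x + y + u * (x⁻¹ ^ a * y⁻¹ ^ 1 : (ZMod p)ˣ) : ZMod p) = 0 then (1 : ℂ) else 0) =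
      ((1 + φ ((x ^ a * (1 + x)) ^ 2 - 4 * x ^ a * u) : ℤ) : ℂ) := by
    intro x
    have hx : (x : ZMod p) ≠ 0 := x.ne_zero
    rw [← sum_units_quadratic hF _ _ _ (pow_ne_zero a hx) u.ne_zero]
    refine Finset.sum_congr rfl fun y _ => if_congr ?_ rfl rfl
    have hy : (y : ZMod p) ≠ 0 := y.ne_zero
    simp only [Units.val_mul, Units.val_pow_eq_pow_val, Units.val_inv_eq_inv_val, inv_pow]
    rw [← mul_left_inj' (mul_ne_zero (pow_ne_zero a hx) hy), zero_mul]
    refine Eq.congr ?_ rfl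
    field_simp
    ring
  simp only [h]
  push_cast
  rw [Finset.sum_add_distrib, Finset.sum_const, Finset.card_univ, nsmul_one, card_units_cast]
  simp only [mul_pow, ← pow_mul, mul_comm a 2]

theorem sum_sum_sub_one (f : (ZMod p)ˣ → (ZMod p)ˣ → ℂ) :
    ∑ x, ∑ y, ((p : ℂ) * f x y - 1) = p * ∑ x, ∑ y, f x y - (p - 1) ^ 2 := by
  simp only [Finset.sum_sub_distrib, ← Finset.mul_sum, Finset.sum_const, Finset.card_univ,
    nsmul_eq_mul, card_units_cast]
  ring

theorem sum_bcmCoeff_three (hF : ringChar (ZMod p) ≠ 2) {ψ : AddChar (ZMod p) ℂ} (hψ : ψ ≠ 1)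
    (u : (ZMod p)ˣ) :
    ∑ χ, bcmCoeff ψ [3] [1, 1, 1] χ * χ u =
      (p - 1) * ((1 + ∑ x : ZMod p, φ (x ^ 2 * (1 + x) ^ 2 - 4 * x * u) : ℤ) : ℂ) := by
  have hp : (p : ℂ) ≠ 0 := Nat.cast_ne_zero.2 (Fact.out : p.Prime).ne_zero
  have h : ∀ χ : MulChar (ZMod p) ℂ, bcmCoeff ψ [3] [1, 1, 1] χ * χ u =
      (p : ℂ)⁻¹ * (gaussSum (χ ^ (1 + 1 + 1)) ψ * (gaussSum (χ ^ 1)⁻¹ ψ *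
        (gaussSum (χ ^ 1)⁻¹ ψ * gaussSum (χ ^ 1)⁻¹ ψ)) * χ u) +
        if χ = 1 then 1 - (p : ℂ)⁻¹ else 0 := by
    intro χ
    by_cases h1 : χ = 1
    · simp [h1, bcmCoeff_one hψ, gaussSum_one_left hψ]
      norm_num
    · simp [bcmCoeff, charMultiplicity, h1]
      ring
  simp only [h]
  rw [Finset.sum_add_distrib, ← Finset.mul_sum, sum_gaussSum_mul_three hψ, sum_sum_sub_one,
    sum_units_torus hF, Finset.sum_ite_eq' _ _ _, if_pos (Finset.mem_univ _),
    sum_units_eq_sum_sub (fun x : ZMod p => ((φ (x ^ (2 * 1) * (1 + x) ^ 2 - 4 * x ^ 1 * u) : ℤ) : ℂ))]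
  simp only [mul_one, pow_one, zero_pow two_ne_zero, zero_mul, mul_zero, sub_zero,
    MulChar.map_zero]
  push_cast
  field_simp
  ring

theorem sum_bcmCoeff_four (hF : ringChar (ZMod p) ≠ 2) {ψ : AddChar (ZMod p) ℂ} (hψ : ψ ≠ 1)
    (u : (ZMod p)ˣ) :
    ∑ χ, bcmCoeff ψ [4] [2, 1, 1] χ * χ u =
      (p - 1) * ((1 + ∑ x : ZMod p, φ (x ^ 2 * (1 + x) ^ 2 - 4 * u) : ℤ) : ℂ) := by
  have hp : (p : ℂ) ≠ 0 := Nat.cast_ne_zero.2 (Fact.out : p.Prime).ne_zero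
  have h : ∀ χ : MulChar (ZMod p) ℂ, bcmCoeff ψ [4] [2, 1, 1] χ * χ u =
      (p : ℂ)⁻¹ * (gaussSum (χ ^ (2 + 1 + 1)) ψ * (gaussSum (χ ^ 2)⁻¹ ψ *
        (gaussSum (χ ^ 1)⁻¹ ψ * gaussSum (χ ^ 1)⁻¹ ψ)) * χ u) +
        ((if χ = 1 then 1 - (p : ℂ)⁻¹ - (p - 1) else 0) +
          (p - 1) * if χ ^ 2 = 1 then χ ((-u : (ZMod p)ˣ) : ZMod p) else 0) := by
    intro χ
    by_cases h1 : χ = 1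
    · simp only [h1, one_pow, if_true, MulChar.one_apply_coe, bcmCoeff_one hψ, inv_one,
        gaussSum_one_left hψ, List.length_cons, List.length_nil]
      ring
    · by_cases h2 : χ ^ 2 = 1
      · have h4 : χ ^ 4 = 1 := by rw [pow_mul χ 2 2, h2, one_pow]
        have hi : χ⁻¹ = χ := inv_eq_of_mul_eq_one_left (by rw [← sq, h2])
        have hg := gaussSum_mul_gaussSum_inv hψ h1
        rw [hi] at hg
        have hu : χ (-(u : ZMod p)) = χ (-1) * χ u := by rw [← map_mul, neg_one_mul]
        simp [bcmCoeff, charMultiplicity, h1, h2, h4, hi, gaussSum_one_left hψ, hg, hu]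
        field_simp
        ring
      · simp [bcmCoeff, charMultiplicity, h1, h2]
        ring
  simp only [h]
  rw [Finset.sum_add_distrib, Finset.sum_add_distrib, ← Finset.mul_sum, ← Finset.mul_sum,
    sum_gaussSum_mul_three hψ, sum_sum_sub_one, sum_units_pow_mul_eq_one,
    sum_units_torus hF, Finset.sum_ite_eq' _ _ _, if_pos (Finset.mem_univ _)]
  have hsq := sum_units_quadratic hF 1 0 u one_ne_zero u.ne_zero
  simp only [one_mul, zero_mul, add_zero, zero_pow two_ne_zero, zero_sub, mul_one] at hsq
  have hsq' : ∀ x : (ZMod p)ˣ, (x ^ 2 = -u) = ((x : ZMod p) ^ 2 + u = 0) := by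
    intro x
    rw [← Units.val_inj, Units.val_neg, Units.val_pow_eq_pow_val, ← eq_neg_iff_add_eq_zero]
  have hterm : ∀ x : (ZMod p)ˣ,
      ((φ ((x : ZMod p) ^ (2 * 2) * (1 + x) ^ 2 - 4 * x ^ 2 * u) : ℤ) : ℂ) =
      ((φ ((x : ZMod p) ^ 2 * (1 + x) ^ 2 - 4 * u) : ℤ) : ℂ) := by
    intro x
    rw [← quadraticChar_mul_sq ((x : ZMod p) ^ 2 * (1 + x) ^ 2 - 4 * u) x.ne_zero]
    congr 3
    ring
  simp only [hsq', hsq, hterm]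
  rw [sum_units_eq_sum_sub (fun x : ZMod p => ((φ (x ^ 2 * (1 + x) ^ 2 - 4 * u) : ℤ) : ℂ))]
  simp only [zero_pow two_ne_zero, zero_mul, zero_sub]
  push_cast
  field_simp
  ring

theorem sum_units_torus_three_two (hF : ringChar (ZMod p) ≠ 2) (u : (ZMod p)ˣ) :
    ∑ x : (ZMod p)ˣ, ∑ y : (ZMod p)ˣ,
      (if (1 + x + y + u * (x⁻¹ ^ 3 * y⁻¹ ^ 2 : (ZMod p)ˣ) : ZMod p) = 0 then (1 : ℂ) else 0) =
    p + ∑ x : ZMod p, ((φ (x ^ 2 - 4 * (x ^ 3 + u)) : ℤ) : ℂ) - (1 + φ (-4 * u)) -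
      ∑ x : (ZMod p)ˣ, if x ^ 3 = -u then 1 else 0 := by
  let e : (ZMod p)ˣ × (ZMod p)ˣ ≃ (ZMod p)ˣ × (ZMod p)ˣ :=
    { toFun := fun z => (z.1 * z.2, z.1 ^ 2 * z.2)
      invFun := fun z => (z.2 * z.1⁻¹, z.1 ^ 2 * z.2⁻¹)
      left_inv := fun z => Prod.ext (Units.ext (by
          simp only [Units.val_mul, Units.val_pow_eq_pow_val, Units.val_inv_eq_inv_val]; field_simp))
        (Units.ext (by
          simp only [Units.val_mul, Units.val_pow_eq_pow_val, Units.val_inv_eq_inv_val]; field_simp))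
      right_inv := fun z => Prod.ext (Units.ext (by
          simp only [Units.val_mul, Units.val_pow_eq_pow_val, Units.val_inv_eq_inv_val]; field_simp))
        (Units.ext (by
          simp only [Units.val_mul, Units.val_pow_eq_pow_val, Units.val_inv_eq_inv_val]; field_simp)) }
  have hsub : ∑ x : (ZMod p)ˣ, ∑ y : (ZMod p)ˣ,
      (if (1 + x + y + u * (x⁻¹ ^ 3 * y⁻¹ ^ 2 : (ZMod p)ˣ) : ZMod p) = 0 then (1 : ℂ) else 0) =
      ∑ x : (ZMod p)ˣ, ∑ y : (ZMod p)ˣ,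
      (if (1 * (y : ZMod p) ^ 2 + x * y + (x ^ 3 + u) : ZMod p) = 0 then (1 : ℂ) else 0) := by
    rw [← Fintype.sum_prod_type', ← Fintype.sum_prod_type']
    refine Fintype.sum_equiv e _ _ fun z => if_congr ?_ rfl rfl
    have hx : (z.1 : ZMod p) ≠ 0 := z.1.ne_zero
    have hy : (z.2 : ZMod p) ≠ 0 := z.2.ne_zero
    simp only [e, Equiv.coe_fn_mk, Units.val_mul, Units.val_pow_eq_pow_val,
      Units.val_inv_eq_inv_val, inv_pow]
    rw [← mul_left_inj' (mul_ne_zero (pow_ne_zero 3 hx) (pow_ne_zero 2 hy)), zero_mul]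
    refine Eq.congr ?_ rfl
    field_simp
    ring
  have hrow : ∀ x : ZMod p, ∑ y : (ZMod p)ˣ,
      (if (1 * (y : ZMod p) ^ 2 + x * y + (x ^ 3 + u) : ZMod p) = 0 then (1 : ℂ) else 0) =
      ((1 + φ (x ^ 2 - 4 * (x ^ 3 + u)) : ℤ) : ℂ) - if x ^ 3 + u = 0 then 1 else 0 := by
    intro x
    rw [sum_units_eq_sum_sub (fun y : ZMod p =>
      if 1 * y ^ 2 + x * y + (x ^ 3 + u) = 0 then (1 : ℂ) else 0), ← mul_one (4 : ZMod p),
      ← card_quadratic_eq hF one_ne_zero, Finset.sum_boole]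
    simp
  rw [hsub, sum_units_eq_sum_sub (fun x : ZMod p => ∑ y : (ZMod p)ˣ,
    if 1 * (y : ZMod p) ^ 2 + x * y + (x ^ 3 + u) = 0 then (1 : ℂ) else 0)]
  simp only [hrow]
  rw [Finset.sum_sub_distrib]
  have hcube : ∑ x : ZMod p, (if x ^ 3 + u = 0 then (1 : ℂ) else 0) =
      ∑ x : (ZMod p)ˣ, if x ^ 3 = -u then 1 else 0 := by
    have h := sum_units_eq_sum_sub (fun x : ZMod p => if x ^ 3 + u = 0 then (1 : ℂ) else 0)
    rw [zero_pow three_ne_zero, zero_add, if_neg u.ne_zero, sub_zero] at h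
    rw [← h]
    refine Finset.sum_congr rfl fun x _ => if_congr ?_ rfl rfl
    rw [← Units.val_inj, Units.val_neg, Units.val_pow_eq_pow_val, ← eq_neg_iff_add_eq_zero]
  rw [hcube, zero_pow three_ne_zero, zero_add, if_neg u.ne_zero, zero_pow two_ne_zero, zero_sub,
    ← neg_mul]
  push_cast
  rw [Finset.sum_add_distrib, Finset.sum_const, Finset.card_univ, ZMod.card, nsmul_one]
  ring

theorem sum_bcmCoeff_six (hF : ringChar (ZMod p) ≠ 2) {ψ : AddChar (ZMod p) ℂ} (hψ : ψ ≠ 1)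
    (u : (ZMod p)ˣ) :
    ∑ χ, bcmCoeff ψ [6] [3, 2, 1] χ * χ u =
      (p - 1) * ((∑ x : ZMod p, φ (x ^ 2 - 4 * (x ^ 3 + u)) : ℤ) : ℂ) := by
  have hp : (p : ℂ) ≠ 0 := Nat.cast_ne_zero.2 (Fact.out : p.Prime).ne_zero
  have h : ∀ χ : MulChar (ZMod p) ℂ, bcmCoeff ψ [6] [3, 2, 1] χ * χ u =
      (p : ℂ)⁻¹ * (gaussSum (χ ^ (3 + 2 + 1)) ψ * (gaussSum (χ ^ 3)⁻¹ ψ *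
        (gaussSum (χ ^ 2)⁻¹ ψ * gaussSum (χ ^ 1)⁻¹ ψ)) * χ u) +
        ((if χ = 1 then 1 - (p : ℂ)⁻¹ - (p - 1) - (p - 1) else 0) +
          ((p - 1) * (if χ ^ 2 = 1 then χ ((-u : (ZMod p)ˣ) : ZMod p) else 0) +
          (p - 1) * if χ ^ 3 = 1 then χ ((-u : (ZMod p)ˣ) : ZMod p) else 0)) := by
    intro χ
    by_cases h1 : χ = 1
    · simp only [h1, one_pow, if_true, MulChar.one_apply_coe, bcmCoeff_one hψ, inv_one,
        gaussSum_one_left hψ, List.length_cons, List.length_nil]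
      ring
    have hg := gaussSum_mul_gaussSum_inv hψ h1
    have hu : χ (-(u : ZMod p)) = χ (-1) * χ u := by rw [← map_mul, neg_one_mul]
    by_cases h2 : χ ^ 2 = 1
    · have h3 : χ ^ 3 = χ := by rw [pow_succ, h2, one_mul]
      have h6 : χ ^ 6 = 1 := by rw [pow_mul χ 2 3, h2, one_pow]
      have hi : χ⁻¹ = χ := inv_eq_of_mul_eq_one_left (by rw [← sq, h2])
      rw [hi] at hg
      simp [bcmCoeff, charMultiplicity, h1, h2, h3, h6, hi, gaussSum_one_left hψ, hg, hu]
      field_simp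
      ring
    · by_cases h3 : χ ^ 3 = 1
      · have h6 : χ ^ 6 = 1 := by rw [pow_mul χ 3 2, h3, one_pow]
        have hi : (χ ^ 2)⁻¹ = χ := inv_eq_of_mul_eq_one_left (by rw [← pow_succ', h3])
        simp [bcmCoeff, charMultiplicity, h1, h2, h3, h6, hi, gaussSum_one_left hψ, hg, hu]
        field_simp
        ring
      · simp [bcmCoeff, charMultiplicity, h1, h2, h3]
        ring
  simp only [h]
  rw [Finset.sum_add_distrib, Finset.sum_add_distrib, Finset.sum_add_distrib, ← Finset.mul_sum,
    ← Finset.mul_sum, ← Finset.mul_sum,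
    sum_gaussSum_mul_three hψ, sum_sum_sub_one, sum_units_pow_mul_eq_one, sum_units_pow_mul_eq_one,
    sum_units_torus_three_two hF, Finset.sum_ite_eq' _ _ _, if_pos (Finset.mem_univ _)]
  have hsq := sum_units_quadratic hF 1 0 u one_ne_zero u.ne_zero
  simp only [one_mul, zero_mul, add_zero, zero_pow two_ne_zero, zero_sub, mul_one, ← neg_mul]
    at hsq
  have hsq' : ∀ x : (ZMod p)ˣ, (x ^ 2 = -u) = ((x : ZMod p) ^ 2 + u = 0) := by
    intro x
    rw [← Units.val_inj, Units.val_neg, Units.val_pow_eq_pow_val, ← eq_neg_iff_add_eq_zero]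
  simp only [hsq', hsq]
  push_cast
  field_simp
  ring

end HypergeometricTransforms

section ClausenFormula

variable {p : ℕ} [Fact p.Prime]

local notation "φ" => quadraticChar (ZMod p)

theorem BCM_eq_of_sum_bcmCoeff {ψ : AddChar (ZMod p) ℂ} {ω : MulChar (ZMod p) ℂ}
    (hω : orderOf ω = p - 1) {P Q : List ℕ} {N : ℤ} (hN : (N : ZMod p) ≠ 0) {f : (ZMod p)ˣ → ℂ}
    (hf : ∀ u : (ZMod p)ˣ, ∑ χ, bcmCoeff ψ P Q χ * χ u = (p - 1) * f u) (u : (ZMod p)ˣ) :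
    BCM p ψ ω P Q N u = (-1) ^ (P.length + Q.length + 1) * f ((Units.mk0 _ hN)⁻¹ * u) := by
  have hp : 1 - (p : ℂ) ≠ 0 :=
    sub_ne_zero.2 (by exact_mod_cast (Fact.out : p.Prime).one_lt.ne)
  have h := hf ((Units.mk0 _ hN)⁻¹ * u)
  rw [Units.val_mul, Units.val_inv_eq_inv_val, Units.val_mk0] at h
  rw [BCM_eq_sum_bcmCoeff ψ hω, h]
  field_simp
  ring

theorem BCM_sq_eq_of_isClausenKernel (hF : ringChar (ZMod p) ≠ 2) {ψ : AddChar (ZMod p) ℂ}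
    (hψ : ψ ≠ 1) {ω : MulChar (ZMod p) ℂ} (hω : orderOf ω = p - 1) {P Q P' Q' : List ℕ} {N : ℤ}
    (h4 : (4 : ZMod p) ≠ 0)
    (hN : (N : ZMod p) ≠ 0) (hPQ : Even (P.length + Q.length)) (hPQ' : Odd (P'.length + Q'.length))
    (hc : ∀ χ : MulChar (ZMod p) ℂ,
      bcmCoeff ψ P' Q' χ = bcmCoeff ψ [2] [1, 1] χ * bcmCoeff ψ P Q χ) {f : ZMod p → ℤ}
    (hf : ∀ u : (ZMod p)ˣ, ∑ χ, bcmCoeff ψ P Q χ * χ u = (p - 1) * (f u : ℂ))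
    (hk : IsClausenKernel fun x => -f ((N : ZMod p)⁻¹ * x)) {t : ZMod p} (ht0 : t ≠ 0)
    (ht1 : t ≠ 1) (ht2 : 2 * t ≠ 1) :
    BCM p ψ ω P Q N t ^ 2 = BCM p ψ ω P' Q' (4 * N) (4 * t * (1 - t)) + p := by
  have hN' : ((4 * N : ℤ) : ZMod p) ≠ 0 := by push_cast; exact mul_ne_zero h4 hN
  have hl : 4 * t * (1 - t) ≠ 0 := mul_ne_zero (mul_ne_zero h4 ht0) (sub_ne_zero.2 ht1.symm)
  have h2 := BCM_eq_of_sum_bcmCoeff hω hN (f := fun u => (f u : ℂ)) hf (Units.mk0 t ht0)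
  have h3 := BCM_eq_of_sum_bcmCoeff hω (P := P') (Q := Q') hN' (ψ := ψ) (fun u => by
    simp only [hc]
    exact mellin_convolution (f₂ := fun u => (f u : ℂ)) (sum_bcmCoeff_two hF hψ) hf u)
      (Units.mk0 _ hl)
  have hker := hk t ht0 ht1 ht2
  rw [ZMod.card] at hker
  rw [Units.val_mk0, hPQ.add_one.neg_one_pow, Units.val_mul, Units.val_inv_eq_inv_val,
    Units.val_mk0, Units.val_mk0] at h2
  rw [Units.val_mk0, hPQ'.add_one.neg_one_pow, one_mul] at h3
  rw [h2, h3]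
  have hconv : ∑ u : (ZMod p)ˣ, ((φ (1 - 4 * u) : ℤ) : ℂ) *
      (f (((Units.mk0 _ hN')⁻¹ * Units.mk0 _ hl * u⁻¹ : (ZMod p)ˣ) : ZMod p) : ℂ) =
      ((∑ x : ZMod p, φ (x * (x - 4 * t * (1 - t))) * f ((N : ZMod p)⁻¹ * x) : ℤ) : ℂ) := by
    have h0 := sum_units_eq_sum_sub (p := p) (R := ℤ) fun x =>
      φ (x * (x - 4 * t * (1 - t))) * f ((N : ZMod p)⁻¹ * x)
    rw [zero_mul, MulChar.map_zero, zero_mul, sub_zero] at h0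
    rw [← h0]
    push_cast
    refine Fintype.sum_equiv
      ((Equiv.inv (ZMod p)ˣ).trans (Equiv.mulLeft (Units.mk0 _ hl * (Units.mk0 _ h4)⁻¹)))
      _ _ fun u => ?_
    have hu : (u : ZMod p) ≠ 0 := u.ne_zero
    simp only [Equiv.trans_apply, Equiv.inv_apply, Equiv.coe_mulLeft, Units.val_mul,
      Units.val_inv_eq_inv_val, Units.val_mk0]
    generalize hl' : 4 * t * (1 - t) = l at hl
    have hφ : φ (1 - 4 * u) = φ (l * 4⁻¹ * (u : ZMod p)⁻¹ * (l * 4⁻¹ * (u : ZMod p)⁻¹ - l)) := by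
      rw [← quadraticChar_mul_sq (1 - 4 * (u : ZMod p))
        (mul_ne_zero (mul_ne_zero hl (inv_ne_zero h4)) (inv_ne_zero hu))]
      congr 1
      field_simp
    have hf' : (4 * (N : ZMod p))⁻¹ * l * (u : ZMod p)⁻¹ =
        (N : ZMod p)⁻¹ * (l * 4⁻¹ * (u : ZMod p)⁻¹) := by
      field_simp
    rw [hφ, hf']
  rw [hconv, ← Int.cast_natCast (R := ℂ) p]
  have : (-1 : ℂ) * (f ((N : ZMod p)⁻¹ * t) : ℂ) = ((-f ((N : ZMod p)⁻¹ * t) : ℤ) : ℂ) := by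
    push_cast; ring
  rw [this, ← Int.cast_pow, hker, ← Int.cast_add]
  simp only [mul_neg, Finset.sum_neg_distrib]
  congr 1
  ring

end ClausenFormula

theorem sum_comp_affine {F : Type*} [Field F] [Fintype F] (g : F → ℤ) {a : F} (ha : a ≠ 0) (b : F) :
    ∑ x, g (a * x + b) = ∑ x, g x :=
  Fintype.sum_equiv ((Equiv.mulLeft₀ a ha).trans (Equiv.addRight b)) _ _ fun _ => rfl

section KernelForms

variable {F : Type*} [Field F] [Fintype F] [DecidableEq F]

local notation "φ" => quadraticChar F

theorem quadraticChar_eq_of_mul_sq_eq {a b c : F} (hc : c ≠ 0) (h : a * c ^ 2 = b) : φ a = φ b := by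
  rw [← h, quadraticChar_mul_sq a hc]

theorem sum_legendre_two (h2 : (2 : F) ≠ 0) (t : F) :
    ∑ x, φ (1 - 4 * x) * φ (x * (x - 4⁻¹ * t)) =
      φ (-1) * ∑ w, φ ((w ^ 2 - 4) * (w - (4 * t - 2))) := by
  have h4 : (4 : F) ≠ 0 := by rw [show (4 : F) = 2 ^ 2 by norm_num]; exact pow_ne_zero _ h2
  have h16 : (16 : F) ≠ 0 := by rw [show (16 : F) = 2 ^ 4 by norm_num]; exact pow_ne_zero _ h2
  have h32 : (32 : F) ≠ 0 := by rw [show (32 : F) = 2 ^ 5 by norm_num]; exact pow_ne_zero _ h2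
  rw [← sum_comp_affine _ (inv_ne_zero h16) (2 * 16⁻¹), Finset.mul_sum]
  refine Finset.sum_congr rfl fun w _ => ?_
  rw [← map_mul, ← map_mul]
  refine quadraticChar_eq_of_mul_sq_eq h32 ?_
  rw [show (32 : F) = 2 * 16 by norm_num]
  field_simp
  ring

theorem sum_legendre_three (h3 : (3 : F) ≠ 0) (t : F) :
    ∑ x, φ (x ^ 2 * (1 + x) ^ 2 - 4 * x * ((-27)⁻¹ * t)) =
      ∑ v, φ (v + 2) * φ (v ^ 3 - 3 * v - (4 * t - 2)) := by
  have h9 : (9 : F) ≠ 0 := by rw [show (9 : F) = 3 ^ 2 by norm_num]; exact pow_ne_zero _ h3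
  have h27 : (27 : F) ≠ 0 := by rw [show (27 : F) = 3 ^ 3 by norm_num]; exact pow_ne_zero _ h3
  rw [← sum_comp_affine _ (neg_ne_zero.2 (inv_ne_zero h3)) (-2 * 3⁻¹)]
  refine Finset.sum_congr rfl fun v _ => ?_
  rw [← map_mul]
  refine quadraticChar_eq_of_mul_sq_eq h9 ?_
  rw [show (-27 : F) = -(3 ^ 3) by norm_num, show (9 : F) = 3 ^ 2 by norm_num]
  field_simp
  ring

theorem sum_legendre_four (hF : ringChar F ≠ 2) {t : F} (ht : t ≠ 0) :
    1 + ∑ x, φ (x ^ 2 * (1 + x) ^ 2 - 4 * (64⁻¹ * t)) =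
      φ 2 * ∑ w, φ (w + 2) * φ (w ^ 2 - 2 - (4 * t - 2)) := by
  have h2 : (2 : F) ≠ 0 := Ring.two_ne_zero hF
  have h4 : (4 : F) ≠ 0 := by rw [show (4 : F) = 2 ^ 2 by norm_num]; exact pow_ne_zero _ h2
  have h64 : (64 : F) ≠ 0 := by rw [show (64 : F) = 2 ^ 6 by norm_num]; exact pow_ne_zero _ h2
  have hsq : ∀ y : F, φ ((2⁻¹ * y + -2⁻¹) ^ 2 * (1 + (2⁻¹ * y + -2⁻¹)) ^ 2 - 4 * (64⁻¹ * t)) =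
      φ ((y ^ 2 - 1) ^ 2 - t) := by
    intro y
    refine quadraticChar_eq_of_mul_sq_eq h4 ?_
    rw [show (64 : F) = 2 ^ 6 by norm_num, show (4 : F) = 2 ^ 2 by norm_num]
    field_simp
    ring
  rw [← sum_comp_affine _ (inv_ne_zero h2) (-2⁻¹), Finset.sum_congr rfl fun y _ => hsq y,
    sum_comp_sq hF fun s => φ ((s - 1) ^ 2 - t),
    ← sum_comp_affine _ one_ne_zero 1]
  have hr : ∀ r : F, (1 + φ (1 * r + 1)) * φ ((1 * r + 1 - 1) ^ 2 - t) =
      φ (r ^ 2 - t) + φ (r + 1) * φ (r ^ 2 - t) := by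
    intro r
    rw [one_mul, add_sub_cancel_right]
    ring
  rw [Finset.sum_congr rfl fun r _ => hr r, Finset.sum_add_distrib,
    sum_quadraticChar_sq_sub hF ht, add_neg_cancel_left, Finset.mul_sum,
    ← sum_comp_affine (fun r => φ (r + 1) * φ (r ^ 2 - t)) (inv_ne_zero h2) 0]
  refine Finset.sum_congr rfl fun w _ => ?_
  rw [← map_mul, ← map_mul, ← map_mul]
  refine quadraticChar_eq_of_mul_sq_eq h4 ?_
  rw [show (4 : F) = 2 ^ 2 by norm_num]
  field_simp
  ring

theorem sum_legendre_six (h2 : (2 : F) ≠ 0) (h3 : (3 : F) ≠ 0) (t : F) :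
    ∑ x, φ (x ^ 2 - 4 * (x ^ 3 + 432⁻¹ * t)) = φ 3 * ∑ v, φ (v ^ 3 - 3 * v - (4 * t - 2)) := by
  have h12 : (12 : F) ≠ 0 := by
    rw [show (12 : F) = 2 ^ 2 * 3 by norm_num]
    exact mul_ne_zero (pow_ne_zero _ h2) h3
  have h36 : (36 : F) ≠ 0 := by
    rw [show (36 : F) = 2 ^ 2 * 3 ^ 2 by norm_num]
    exact mul_ne_zero (pow_ne_zero _ h2) (pow_ne_zero _ h3)
  rw [← sum_comp_affine _ (neg_ne_zero.2 (inv_ne_zero h12)) 12⁻¹, Finset.mul_sum]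
  refine Finset.sum_congr rfl fun v _ => ?_
  rw [← map_mul]
  refine quadraticChar_eq_of_mul_sq_eq h36 ?_
  rw [show (432 : F) = 3 * 12 ^ 2 by norm_num, show (36 : F) = 3 * 12 by norm_num]
  field_simp
  ring

end KernelForms

/-- Finite-field Clausen formula with quadratic transformation:
`H_p({1/d,(d-1)/d},{1,1};t)² = H_p({1/2,1/d,(d-1)/d},{1,1,1}; 4t(1-t)) + p`
for `p > 3` prime with `p ∤ 2d`, `d ∈ {2,3,4,6}`, and `t ∉ {0, 1, 1/2}`. -/
theorem stmt16 (p d : ℕ) [Fact p.Prime] (hp : 3 < p)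
    (hd : d = 2 ∨ d = 3 ∨ d = 4 ∨ d = 6) (hpd : ¬ p ∣ 2 * d)
    (ψ : AddChar (ZMod p) ℂ) (hψ : ψ ≠ 1)
    (ω : MulChar (ZMod p) ℂ) (hω : orderOf ω = p - 1)
    (t : ZMod p) (ht0 : t ≠ 0) (ht1 : t ≠ 1) (ht2 : t ≠ 2⁻¹) :
    (BCM p ψ ω (P₂ d) (Q₂ d) (N₂ d) t) ^ 2 =
      BCM p ψ ω (P₃ d) (Q₃ d) (N₃ d) (4 * t * (1 - t)) + p := by
  have hp' : p.Prime := Fact.out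
  have hprime : ∀ q : ℕ, q.Prime → q < p → ((q : ℕ) : ZMod p) ≠ 0 := fun q hq hqp h =>
    hqp.ne' ((Nat.prime_dvd_prime_iff_eq hp' hq).1 ((ZMod.natCast_eq_zero_iff q p).1 h))
  have h2 : (2 : ZMod p) ≠ 0 := by exact_mod_cast hprime 2 Nat.prime_two (by omega)
  have h3 : (3 : ZMod p) ≠ 0 := by exact_mod_cast hprime 3 Nat.prime_three hp
  have h4 : (4 : ZMod p) ≠ 0 := by
    rw [show (4 : ZMod p) = 2 ^ 2 by norm_num]; exact pow_ne_zero _ h2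
  have hF : ringChar (ZMod p) ≠ 2 := by rw [ZMod.ringChar_zmod_n]; omega
  have hcard : ¬ 3 ∣ Fintype.card (ZMod p) := by
    rw [ZMod.card, Nat.prime_dvd_prime_iff_eq Nat.prime_three hp']; omega
  have ht2' : 2 * t ≠ 1 := fun h => ht2 (eq_inv_of_mul_eq_one_right h)
  rcases hd with rfl | rfl | rfl | rfl
  · have hN : ((16 : ℤ) : ZMod p) ≠ 0 := by
      push_cast; rw [show (16 : ZMod p) = 2 ^ 4 by norm_num]; exact pow_ne_zero _ h2
    refine BCM_sq_eq_of_isClausenKernel hF hψ hω (P := [2, 2]) (Q := [1, 1, 1, 1])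
      (P' := [2, 2, 2]) (Q' := [1, 1, 1, 1, 1, 1]) h4 hN (by decide) (by decide)
      (bcmCoeff_two_two_two hψ)
      (f := fun u => ∑ x : (ZMod p)ˣ, quadraticChar (ZMod p) (1 - 4 * x) *
        quadraticChar (ZMod p) (1 - 4 * (u * (x : ZMod p)⁻¹)))
      (fun u => ?_) (isClausenKernel_two hF fun x _ => ?_) ht0 ht1 ht2'
    · simp only [bcmCoeff_two_two hψ]
      rw [mellin_convolution (sum_bcmCoeff_two hF hψ) (sum_bcmCoeff_two hF hψ) u]
      push_cast
      simp only
    · have hsum := sum_units_eq_sum_sub (p := p) (R := ℤ) fun y =>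
        quadraticChar (ZMod p) (1 - 4 * y) * quadraticChar (ZMod p) (y * (y - 4⁻¹ * x))
      rw [zero_mul, MulChar.map_zero, mul_zero, sub_zero, sum_legendre_two h2] at hsum
      rw [neg_mul, ← hsum]
      refine congrArg _ (Finset.sum_congr rfl fun y _ => congrArg _ ?_)
      have hy : (y : ZMod p) ≠ 0 := y.ne_zero
      refine quadraticChar_eq_of_mul_sq_eq hy ?_
      rw [show ((16 : ℤ) : ZMod p) = 4 * 4 by norm_num]
      field_simp
  · have hN : ((-27 : ℤ) : ZMod p) ≠ 0 := by
      push_cast; rw [show (27 : ZMod p) = 3 ^ 3 by norm_num]; exact neg_ne_zero.2 (pow_ne_zero _ h3)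
    refine BCM_sq_eq_of_isClausenKernel hF hψ hω (P := [3]) (Q := [1, 1, 1])
      (P' := [2, 3]) (Q' := [1, 1, 1, 1, 1]) h4 hN (by decide) (by decide)
      (bcmCoeff_two_three hψ) (f := fun u => 1 + ∑ x : ZMod p,
        quadraticChar (ZMod p) (x ^ 2 * (1 + x) ^ 2 - 4 * x * u))
      (sum_bcmCoeff_three hF hψ) (isClausenKernel_three hF hcard h3 fun x _ => ?_) ht0 ht1 ht2'
    push_cast
    rw [sum_legendre_three h3]
    ring
  · have hN : ((64 : ℤ) : ZMod p) ≠ 0 := by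
      push_cast; rw [show (64 : ZMod p) = 2 ^ 6 by norm_num]; exact pow_ne_zero _ h2
    refine BCM_sq_eq_of_isClausenKernel hF hψ hω (P := [4]) (Q := [2, 1, 1])
      (P' := [4]) (Q' := [1, 1, 1, 1]) h4 hN (by decide) (by decide)
      (bcmCoeff_four hψ) (f := fun u => 1 + ∑ x : ZMod p,
        quadraticChar (ZMod p) (x ^ 2 * (1 + x) ^ 2 - 4 * u))
      (sum_bcmCoeff_four hF hψ) (isClausenKernel_four hF fun x hx => ?_) ht0 ht1 ht2'
    push_cast
    rw [sum_legendre_four hF hx, neg_mul]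
  · have hN : ((432 : ℤ) : ZMod p) ≠ 0 := by
      push_cast
      rw [show (432 : ZMod p) = 2 ^ 4 * 3 ^ 3 by norm_num]
      exact mul_ne_zero (pow_ne_zero _ h2) (pow_ne_zero _ h3)
    refine BCM_sq_eq_of_isClausenKernel hF hψ hω (P := [6]) (Q := [3, 2, 1])
      (P' := [6]) (Q' := [3, 1, 1, 1]) h4 hN (by decide) (by decide)
      (bcmCoeff_six hψ) (f := fun u => ∑ x : ZMod p,
        quadraticChar (ZMod p) (x ^ 2 - 4 * (x ^ 3 + u)))
      (sum_bcmCoeff_six hF hψ) (isClausenKernel_six hF hcard h3 fun x _ => ?_) ht0 ht1 ht2'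
    push_cast
    rw [sum_legendre_six h2 h3, neg_mul]
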